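/- arXiv:2103.13542 — 3 statements merged into one kernel-verified Lean document; each statement's English description precedes it below -/
import Mathlib

section
/- Let ℓ be a tuple of nonnegative integers indexed by the Dirichlet characters modulo q with |ℓ| = k. Then there is a constant C depending only on k such that, uniformly for all complex s with Re s ≥ 1/2 and all real X > q², one has 𝓟_X^ℓ(s) = 𝓟*_X^ℓ(s)·(1 + E) with |E| ≤ C/log X. -/
open Complex Filter MeasureTheory Finset HurwitzZeta
open scoped ArithmeticFunction Real Classical

noncomputable section

/-- The finite set of primes `p ≤ X`. -/
def primesUpTo (X : ℝ) : Finset ℕ :=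
  (Finset.range (Nat.floor X + 1)).filter (fun p => p.Prime ∧ (p : ℝ) ≤ X)

/-- The finite set of naturals `n ≤ X`. -/
def natsUpTo (X : ℝ) : Finset ℕ :=
  (Finset.range (Nat.floor X + 1)).filter (fun n => (n : ℝ) ≤ X)

/-- Truncated Euler product `P_X(s,χ)`, defined via the primitive character `χ*` inducing `χ`:
`P_X(s,χ) = ∏_{p ∣ q} (1 - χ*(p) p^{-s}) · exp(∑_{n ≤ X} χ*(n) Λ(n) / (n^s log n))`. -/
def PX {q : ℕ} (X : ℝ) (χ : DirichletCharacter ℂ q) (s : ℂ) : ℂ :=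
  (∏ p ∈ q.primeFactors, (1 - χ.primitiveCharacter ((p : ℕ) : ZMod χ.conductor) * (p : ℂ) ^ (-s))) *
    Complex.exp (∑ n ∈ natsUpTo X,
      χ.primitiveCharacter ((n : ℕ) : ZMod χ.conductor) * (Λ n : ℂ) / ((n : ℂ) ^ s * (Real.log n : ℂ)))

/-- `𝓟_X^ℓ(s) = ∏_χ P_X(s,χ)^{ℓ_χ}`. -/
def PXl {q : ℕ} (X : ℝ) (ℓ : DirichletCharacter ℂ q → ℕ) (s : ℂ) : ℂ :=
  ∏ χ : DirichletCharacter ℂ q, (PX X χ s) ^ (ℓ χ)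

/-- A Dirichlet character as an arithmetic function. -/
def chiArith {q : ℕ} (χ : DirichletCharacter ℂ q) : ArithmeticFunction ℂ :=
  ⟨fun n => if n = 0 then 0 else χ ((n : ℕ) : ZMod q), by simp⟩

/-- `d_ℓ`, the coefficients of the Dirichlet series of `𝓛^ℓ(s) = ∏_χ L(s,χ)^{ℓ_χ}`,
i.e. the Dirichlet convolution product `∏_χ χ^{*ℓ_χ}`. -/
def dcoef {q : ℕ} (ℓ : DirichletCharacter ℂ q → ℕ) : ArithmeticFunction ℂ :=
  ∏ χ : DirichletCharacter ℂ q, (chiArith χ) ^ (ℓ χ)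

/-- `P*_X(s,χ) = ∏_{p ≤ X}(1 − χ(p)p^{−s})^{−1} · ∏_{√X < p ≤ X}(1 + χ(p)²/(2p^{2s}))^{−1}`. -/
def PstarX {q : ℕ} (X : ℝ) (χ : DirichletCharacter ℂ q) (s : ℂ) : ℂ :=
  ((primesUpTo X).prod (fun p : ℕ => (1 - χ ((p : ℕ) : ZMod q) * (p : ℂ) ^ (-s))⁻¹)) *
    ((primesUpTo X).filter (fun p : ℕ => Real.sqrt X < (p : ℝ))).prod
      (fun p : ℕ => (1 + χ ((p : ℕ) : ZMod q) ^ 2 / (2 * (p : ℂ) ^ (2 * s)))⁻¹)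

/-- `𝓟*_X^ℓ(s) = ∏_χ P*_X(s,χ)^{ℓ_χ}`. -/
def PstarXl {q : ℕ} (X : ℝ) (ℓ : DirichletCharacter ℂ q → ℕ) (s : ℂ) : ℂ :=
  ∏ χ : DirichletCharacter ℂ q, (PstarX X χ s) ^ (ℓ χ)

/-- `Q_X(s,χ) = ∏_{p ≤ √X}(1 − χ(p)p^{−s}) · ∏_{√X < p ≤ X}(1 − χ(p)p^{−s} + χ(p)²/(2p^{2s}))`. -/
def QX {q : ℕ} (X : ℝ) (χ : DirichletCharacter ℂ q) (s : ℂ) : ℂ :=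
  (((primesUpTo X).filter (fun p : ℕ => (p : ℝ) ≤ Real.sqrt X)).prod
      (fun p : ℕ => 1 - χ ((p : ℕ) : ZMod q) * (p : ℂ) ^ (-s))) *
    ((primesUpTo X).filter (fun p : ℕ => Real.sqrt X < (p : ℝ))).prod
      (fun p : ℕ => 1 - χ ((p : ℕ) : ZMod q) * (p : ℂ) ^ (-s)
        + χ ((p : ℕ) : ZMod q) ^ 2 / (2 * (p : ℂ) ^ (2 * s)))

/-- `𝓠_X^ℓ(s) = ∏_χ Q_X(s,χ)^{ℓ_χ}`. -/
def QXl {q : ℕ} (X : ℝ) (ℓ : DirichletCharacter ℂ q → ℕ) (s : ℂ) : ℂ :=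
  ∏ χ : DirichletCharacter ℂ q, (QX X χ s) ^ (ℓ χ)

/-- `𝓛^ℓ(s) = ∏_χ L(s,χ)^{ℓ_χ}`. -/
def Ll {q : ℕ} [NeZero q] (ℓ : DirichletCharacter ℂ q → ℕ) (s : ℂ) : ℂ :=
  ∏ χ : DirichletCharacter ℂ q, (DirichletCharacter.LFunction χ s) ^ (ℓ χ)

/-- GRH for the Dirichlet L-functions modulo `q`: every zero `ρ` of `L(s,χ)` with
`0 < Re ρ < 1` satisfies `Re ρ = 1/2`. -/
def GRHmod (q : ℕ) [NeZero q] : Prop :=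
  ∀ χ : DirichletCharacter ℂ q, ∀ ρ : ℂ,
    DirichletCharacter.LFunction χ ρ = 0 → 0 < ρ.re → ρ.re < 1 → ρ.re = 1 / 2

end

theorem mem_primesUpTo {X : ℝ} {p : ℕ} : p ∈ primesUpTo X ↔ p.Prime ∧ (p : ℝ) ≤ X := by
  simp only [primesUpTo, Finset.mem_filter, Finset.mem_range, Nat.lt_succ_iff,
    and_iff_right_iff_imp]
  exact fun h => Nat.le_floor h.2

theorem mem_natsUpTo {X : ℝ} {n : ℕ} : n ∈ natsUpTo X ↔ (n : ℝ) ≤ X := by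
  simp only [natsUpTo, Finset.mem_filter, Finset.mem_range, Nat.lt_succ_iff,
    and_iff_right_iff_imp]
  exact Nat.le_floor

/-- A sum over the prime powers up to `X`, regrouped by primes. -/
theorem sum_natsUpTo_eq_sum_primesUpTo {M : Type*} [AddCommMonoid M] {X : ℝ} (hX : 0 ≤ X)
    (f : ℕ → M) (hf : ∀ n, ¬ IsPrimePow n → f n = 0) :
    ∑ n ∈ natsUpTo X, f n =
      ∑ p ∈ primesUpTo X, ∑ k ∈ Finset.Icc 1 (Nat.log p ⌊X⌋₊), f (p ^ k) := by
  rw [← Finset.sum_filter_of_ne (p := IsPrimePow) fun n _ h => by_contra fun hn => h (hf n hn),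
    Finset.sum_sigma']
  symm
  refine Finset.sum_bij (fun x _ => x.1 ^ x.2) ?_ ?_ ?_ fun _ _ => rfl
  · rintro ⟨p, k⟩ h
    simp only [Finset.mem_sigma, mem_primesUpTo, Finset.mem_Icc] at h
    obtain ⟨⟨hp, hpX⟩, hk1, hk2⟩ := h
    simp only [Finset.mem_filter, mem_natsUpTo]
    refine ⟨?_, hp.isPrimePow.pow (Nat.ne_of_gt hk1)⟩
    exact (Nat.le_floor_iff hX).1
      (Nat.pow_le_of_le_log (hp.pos.trans_le (Nat.le_floor hpX)).ne' hk2)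
  · rintro ⟨p, k⟩ h ⟨p', k'⟩ h' heq
    simp only [Finset.mem_sigma, mem_primesUpTo, Finset.mem_Icc] at h h'
    obtain ⟨rfl, rfl⟩ := h.1.1.pow_inj' h'.1.1 (Nat.ne_of_gt h.2.1) (Nat.ne_of_gt h'.2.1) heq
    rfl
  · intro n hn
    simp only [Finset.mem_filter, mem_natsUpTo] at hn
    obtain ⟨hnX, p, k, hp, hk, rfl⟩ := hn
    have hp := hp.nat_prime
    refine ⟨⟨p, k⟩, ?_, rfl⟩
    simp only [Finset.mem_sigma, mem_primesUpTo, Finset.mem_Icc]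
    refine ⟨⟨hp, le_trans ?_ hnX⟩, hk, Nat.le_log_of_pow_le hp.one_lt (Nat.le_floor hnX)⟩
    exact_mod_cast Nat.le_self_pow hk.ne' p

/-- The prime power terms of the exponent of `PX` are terms of a logarithmic series. -/
theorem prime_pow_term_eq {m : ℕ} (ψ : DirichletCharacter ℂ m) (s : ℂ) {p k : ℕ} (hp : p.Prime)
    (hk : k ≠ 0) :
    ψ ((p ^ k : ℕ) : ZMod m) * (Λ (p ^ k) : ℂ) /
        (((p ^ k : ℕ) : ℂ) ^ s * (Real.log (p ^ k : ℕ) : ℂ)) =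
      (ψ ((p : ℕ) : ZMod m) * (p : ℂ) ^ (-s)) ^ k / k := by
  have hlog : (Real.log p : ℂ) ≠ 0 := by
    exact_mod_cast (Real.log_pos (by exact_mod_cast hp.one_lt)).ne'
  rw [Complex.natCast_log] at hlog
  have hp0 : (p : ℂ) ^ s ≠ 0 := by simp [Complex.cpow_eq_zero_iff, hp.ne_zero]
  rw [ArithmeticFunction.vonMangoldt_apply_pow hk, ArithmeticFunction.vonMangoldt_apply_prime hp]
  push_cast
  rw [← Complex.natCast_cpow_natCast_mul, Complex.cpow_nat_mul, Real.log_pow, Complex.cpow_neg,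
    map_pow, mul_pow, inv_pow]
  push_cast
  have : (k : ℂ) ≠ 0 := by exact_mod_cast hk
  field_simp

/-- Truncating the logarithmic series of `1 - a`. -/
theorem exists_one_sub_mul_exp_eq {a : ℂ} (ha : ‖a‖ < 1) (K : ℕ) :
    ∃ d : ℂ, (1 - a) * Complex.exp (∑ k ∈ Finset.Icc 1 K, a ^ k / k) = Complex.exp d ∧
      ‖d‖ ≤ ‖a‖ ^ (K + 1) * (1 - ‖a‖)⁻¹ / (K + 1) := by
  have h1 : 1 - a ≠ 0 := by
    intro h
    rw [← sub_eq_zero.1 h] at ha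
    simp at ha
  have hsum : Complex.logTaylor (K + 1) (-a) = -∑ k ∈ Finset.Icc 1 K, a ^ k / k := by
    rw [Complex.logTaylor, Finset.range_eq_Ico, Finset.sum_eq_sum_Ico_succ_bot (by omega),
      ← Finset.sum_neg_distrib]
    simp only [Nat.cast_zero, div_zero, zero_add]
    refine Finset.sum_congr rfl fun k _ => ?_
    rw [neg_pow a, ← mul_assoc, ← pow_add, show k + 1 + k = 2 * k + 1 by ring, pow_succ, pow_mul]
    simp [neg_div]
  refine ⟨Complex.log (1 + -a) - Complex.logTaylor (K + 1) (-a), ?_, ?_⟩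
  · rw [hsum, sub_neg_eq_add, Complex.exp_add, ← sub_eq_add_neg, Complex.exp_log h1]
  · simpa using Complex.norm_log_sub_logTaylor_le K (z := -a) (by simpa using ha)

/-- The local factor at a large prime. -/
theorem exists_one_sub_mul_exp_mul_eq {a : ℂ} (ha : ‖a‖ ≤ 3 / 4) :
    1 + a ^ 2 / 2 ≠ 0 ∧ ∃ d : ℂ, (1 - a) * Complex.exp a * (1 + a ^ 2 / 2) = Complex.exp d ∧
      ‖d‖ ≤ 3 * ‖a‖ ^ 3 := by
  have h0 := norm_nonneg a
  have hz : ‖a ^ 2 / 2‖ = ‖a‖ ^ 2 / 2 := by simp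
  have hz1 : ‖a ^ 2 / 2‖ ≤ 1 / 2 := by rw [hz]; nlinarith
  have hne : 1 + a ^ 2 / 2 ≠ 0 := by
    intro h
    rw [add_eq_zero_iff_neg_eq.1 h |>.symm] at hz1
    norm_num at hz1
  obtain ⟨d, hd, hdn⟩ := exists_one_sub_mul_exp_eq (ha.trans_lt (by norm_num)) 2
  have hinv : (1 - ‖a‖)⁻¹ ≤ 4 := by
    rw [inv_le_comm₀ (by linarith) (by norm_num)]; linarith
  refine ⟨hne, d + (Complex.log (1 + a ^ 2 / 2) - a ^ 2 / 2), ?_, ?_⟩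
  · rw [Complex.exp_add, Complex.exp_sub, Complex.exp_log hne, ← hd]
    simp only [show Finset.Icc 1 2 = ({1, 2} : Finset ℕ) by rfl]
    rw [Finset.sum_pair (by norm_num), Complex.exp_add]
    have := Complex.exp_ne_zero (a ^ 2 / 2)
    push_cast
    rw [pow_one, div_one]
    field_simp
  · have h2 := Complex.norm_log_one_add_sub_self_le (z := a ^ 2 / 2) (by linarith)
    have hinv2 : (1 - ‖a ^ 2 / 2‖)⁻¹ ≤ 2 := by
      rw [inv_le_comm₀ (by linarith) (by norm_num)]; linarith
    calc ‖d + (Complex.log (1 + a ^ 2 / 2) - a ^ 2 / 2)‖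
        ≤ ‖a‖ ^ 3 * 4 / 3 + ‖a ^ 2 / 2‖ ^ 2 * 2 / 2 := by
          refine (norm_add_le _ _).trans (add_le_add (hdn.trans ?_) (h2.trans ?_))
          · norm_num
            gcongr
          · gcongr
      _ ≤ 3 * ‖a‖ ^ 3 := by
          rw [hz]
          nlinarith [pow_nonneg h0 3]

theorem norm_char_mul_cpow_neg_le {m : ℕ} (ψ : DirichletCharacter ℂ m) {s : ℂ} (hs : 1 / 2 ≤ s.re)
    {p : ℕ} (hp : p.Prime) :
    ‖ψ ((p : ℕ) : ZMod m) * (p : ℂ) ^ (-s)‖ ≤ (p : ℝ) ^ (-(1 / 2) : ℝ) := by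
  rw [norm_mul, Complex.norm_natCast_cpow_of_pos hp.pos]
  refine (mul_le_of_le_one_left (by positivity) (ψ.norm_le_one _)).trans ?_
  refine Real.rpow_le_rpow_of_exponent_le (by exact_mod_cast hp.one_le) ?_
  rw [Complex.neg_re]
  linarith

theorem rpow_neg_half_le {p : ℕ} (hp : p.Prime) : (p : ℝ) ^ (-(1 / 2) : ℝ) ≤ 3 / 4 := by
  have h2 : (2 : ℝ) ≤ p := by exact_mod_cast hp.two_le
  rw [Real.rpow_neg (by positivity), ← Real.sqrt_eq_rpow, inv_le_comm₀ (by positivity) (by norm_num)]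
  exact Real.le_sqrt_of_sq_le (by linarith)

/-- The remainder of the logarithmic series at a prime, truncated at the powers up to `X`. -/
theorem log_series_remainder_le {a : ℂ} {p : ℕ} (hp : p.Prime) {X : ℝ} (hX : 1 < X)
    (ha : ‖a‖ ≤ (p : ℝ) ^ (-(1 / 2) : ℝ)) :
    ‖a‖ ^ (Nat.log p ⌊X⌋₊ + 1) * (1 - ‖a‖)⁻¹ / ((Nat.log p ⌊X⌋₊ : ℝ) + 1) ≤
      4 * Real.log p / Real.sqrt X / Real.log X := by
  have hX0 : 0 < X := by linarith
  have hlogX : 0 < Real.log X := Real.log_pos hX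
  have ha' := ha.trans (rpow_neg_half_le hp)
  set K := Nat.log p ⌊X⌋₊
  have hlt : X < (p : ℝ) ^ (K + 1) := by
    have := Nat.lt_pow_succ_log_self hp.one_lt ⌊X⌋₊
    rw [Nat.floor_lt hX0.le] at this
    exact_mod_cast this
  have hpow : ‖a‖ ^ (K + 1) ≤ (Real.sqrt X)⁻¹ := by
    calc ‖a‖ ^ (K + 1) ≤ ((p : ℝ) ^ (-(1 / 2) : ℝ)) ^ (K + 1) := by gcongr
      _ = (Real.sqrt ((p : ℝ) ^ (K + 1)))⁻¹ := by
        rw [Real.rpow_neg p.cast_nonneg, ← Real.sqrt_eq_rpow, inv_pow,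
          Real.sqrt_eq_rpow, Real.sqrt_eq_rpow, Real.rpow_pow_comm p.cast_nonneg]
      _ ≤ (Real.sqrt X)⁻¹ := by gcongr
  have hK : Real.log X ≤ (K + 1) * Real.log p := by
    have := Real.log_le_log hX0 hlt.le
    rw [Real.log_pow] at this
    exact_mod_cast this
  have hinv : (1 - ‖a‖)⁻¹ ≤ 4 := by
    rw [inv_le_comm₀ (by linarith) (by norm_num)]; linarith
  have hinv0 : 0 ≤ (1 - ‖a‖)⁻¹ := inv_nonneg.2 (by linarith)
  have hKinv : 1 / ((K : ℝ) + 1) ≤ Real.log p / Real.log X := by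
    rw [div_le_div_iff₀ (by positivity) hlogX]
    linarith
  calc ‖a‖ ^ (K + 1) * (1 - ‖a‖)⁻¹ / (K + 1)
      ≤ (Real.sqrt X)⁻¹ * 4 / (K + 1) := by gcongr
    _ = (Real.sqrt X)⁻¹ * 4 * (1 / (K + 1)) := by ring
    _ ≤ (Real.sqrt X)⁻¹ * 4 * (Real.log p / Real.log X) :=
      mul_le_mul_of_nonneg_left hKinv (by positivity)
    _ = 4 * Real.log p / Real.sqrt X / Real.log X := by ring

theorem primitiveCharacter_natCast_of_coprime {q : ℕ} (χ : DirichletCharacter ℂ q) {n : ℕ}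
    (h : n.Coprime q) :
    χ.primitiveCharacter ((n : ℕ) : ZMod χ.conductor) = χ ((n : ℕ) : ZMod q) := by
  simpa using χ.primitiveCharacter_apply_of_isCoprime (Nat.isCoprime_iff_coprime.2 h)

/-- The contribution of a prime to the error exponent, up to the factor `1 / log X`. -/
noncomputable def errBound (X : ℝ) (p : ℕ) : ℝ :=
  if Real.sqrt X < p then 24 * (p : ℝ) ^ (-(5 / 4) : ℝ) else 4 * Real.log p / Real.sqrt X

theorem sum_errBound_le {X : ℝ} (hX : 0 < X) :
    ∑ p ∈ primesUpTo X, errBound X p ≤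
      ∑' n : ℕ, 24 * (n : ℝ) ^ (-(5 / 4) : ℝ) + 4 * Real.log 4 := by
  have hsum : Summable fun n : ℕ => 24 * (n : ℝ) ^ (-(5 / 4) : ℝ) :=
    (Real.summable_nat_rpow.2 (by norm_num)).mul_left _
  simp only [errBound]
  rw [Finset.sum_ite]
  refine add_le_add (hsum.sum_le_tsum _ fun n _ => by positivity) ?_
  have hsub : ({p ∈ primesUpTo X | ¬ Real.sqrt X < (p : ℝ)} : Finset ℕ) ⊆
      {p ∈ Finset.Ioc 0 ⌊Real.sqrt X⌋₊ | p.Prime} := by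
    intro p hp
    simp only [Finset.mem_filter, mem_primesUpTo, not_lt, Finset.mem_Ioc] at hp ⊢
    exact ⟨⟨hp.1.1.pos, Nat.le_floor hp.2⟩, hp.1.1⟩
  have hθ := Chebyshev.theta_le_log4_mul_x (Real.sqrt_nonneg X)
  have hpos : 0 < Real.sqrt X := Real.sqrt_pos.2 hX
  rw [← Finset.sum_div, ← Finset.mul_sum, div_le_iff₀ hpos, mul_assoc]
  refine mul_le_mul_of_nonneg_left (le_trans ?_ hθ) (by norm_num)
  exact Finset.sum_le_sum_of_subset_of_nonneg hsub fun n _ _ => Real.log_natCast_nonneg n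

/-- The local factor of `PX` at a prime `p ≤ X`, compared with that of `PstarX`. -/
theorem exists_local_factor_eq {q : ℕ} [NeZero q] (χ : DirichletCharacter ℂ q) {s : ℂ}
    (hs : 1 / 2 ≤ s.re) {X : ℝ} (hX : (q : ℝ) ^ 2 < X) {p : ℕ} (hp : p ∈ primesUpTo X) :
    ∃ d : ℂ,
      (if p ∣ q then 1 - χ.primitiveCharacter ((p : ℕ) : ZMod χ.conductor) * (p : ℂ) ^ (-s)
          else 1) *
        Complex.exp (∑ k ∈ Finset.Icc 1 (Nat.log p ⌊X⌋₊),
          (χ.primitiveCharacter ((p : ℕ) : ZMod χ.conductor) * (p : ℂ) ^ (-s)) ^ k / k) =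
      (1 - χ ((p : ℕ) : ZMod q) * (p : ℂ) ^ (-s))⁻¹ *
        (if Real.sqrt X < (p : ℝ)
          then (1 + χ ((p : ℕ) : ZMod q) ^ 2 / (2 * (p : ℂ) ^ (2 * s)))⁻¹ else 1) *
        Complex.exp d ∧
      ‖d‖ ≤ errBound X p / Real.log X := by
  obtain ⟨hp, hpX⟩ := mem_primesUpTo.1 hp
  have hp2 : (2 : ℝ) ≤ p := by exact_mod_cast hp.two_le
  have hX0 : 0 < X := by linarith
  have hlogX : 0 < Real.log X := Real.log_pos (by linarith)
  set a := χ.primitiveCharacter ((p : ℕ) : ZMod χ.conductor) * (p : ℂ) ^ (-s) with ha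
  have han : ‖a‖ ≤ (p : ℝ) ^ (-(1 / 2) : ℝ) := norm_char_mul_cpow_neg_le _ hs hp
  have han' : ‖a‖ ≤ 3 / 4 := han.trans (rpow_neg_half_le hp)
  have h1a : 1 - a ≠ 0 := by
    intro h
    rw [← sub_eq_zero.1 h] at han'
    norm_num at han'
  have hndvd (h : ¬ p ∣ q) : χ ((p : ℕ) : ZMod q) * (p : ℂ) ^ (-s) = a := by
    rw [ha, primitiveCharacter_natCast_of_coprime χ ((Nat.Prime.coprime_iff_not_dvd hp).2 h)]
  have hdvd (h : p ∣ q) : χ ((p : ℕ) : ZMod q) = 0 := by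
    refine χ.map_nonunit fun hu => ?_
    exact (Nat.Prime.coprime_iff_not_dvd hp).1 ((ZMod.isUnit_iff_coprime p q).1 hu) h
  rw [errBound]
  split_ifs with hq hlarge hlarge
  · exfalso
    have : (p : ℝ) ≤ q := by exact_mod_cast Nat.le_of_dvd (NeZero.pos q) hq
    have : (q : ℝ) ≤ Real.sqrt X := Real.le_sqrt_of_sq_le hX.le
    linarith
  rotate_left
  · have hpX2 : X < (p : ℝ) ^ 2 := (Real.sqrt_lt' (by linarith)).1 hlarge
    have hlog : Nat.log p ⌊X⌋₊ = 1 := by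
      refine (Nat.log_eq_iff (Or.inl one_ne_zero)).2 ⟨?_, ?_⟩
      · simpa using Nat.le_floor hpX
      · rw [Nat.floor_lt hX0.le]
        exact_mod_cast hpX2
    obtain ⟨hne, d, hd, hdn⟩ := exists_one_sub_mul_exp_mul_eq han'
    have hsq : χ ((p : ℕ) : ZMod q) ^ 2 / (2 * (p : ℂ) ^ (2 * s)) = a ^ 2 / 2 := by
      rw [← hndvd hq, mul_pow, Complex.cpow_neg, ← Nat.cast_ofNat (R := ℂ) (n := 2),
        Complex.cpow_nat_mul]
      field_simp
    refine ⟨d, ?_, hdn.trans ?_⟩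
    · rw [hlog, hsq, hndvd hq, ← hd]
      simp only [Finset.Icc_self, Finset.sum_singleton, pow_one, Nat.cast_one, div_one, one_mul]
      generalize 1 + a ^ 2 / 2 = b at hne
      field_simp
    · rw [le_div_iff₀ hlogX]
      have hl : Real.log X ≤ 8 * (p : ℝ) ^ (1 / 4 : ℝ) := by
        have h1 : Real.log X ≤ 2 * Real.log p := by
          have := Real.log_le_log hX0 hpX2.le
          rwa [Real.log_pow] at this
        have h2 := Real.log_le_rpow_div (x := p) (by linarith) (ε := 1 / 4) (by norm_num)
        linarith
      calc 3 * ‖a‖ ^ 3 * Real.log X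
          ≤ 3 * ((p : ℝ) ^ (-(1 / 2) : ℝ)) ^ 3 * (8 * (p : ℝ) ^ (1 / 4 : ℝ)) := by gcongr
        _ = 24 * (p : ℝ) ^ (-(5 / 4) : ℝ) := by
          rw [← Real.rpow_mul_natCast (by linarith),
            show (-(5 / 4) : ℝ) = -(1 / 2) * (3 : ℕ) + 1 / 4 by norm_num,
            Real.rpow_add (by linarith)]
          ring
  all_goals
    obtain ⟨d, hd, hdn⟩ := exists_one_sub_mul_exp_eq (han'.trans_lt (by norm_num)) (Nat.log p ⌊X⌋₊)
    refine ⟨d, ?_, hdn.trans (log_series_remainder_le hp (by linarith) han)⟩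
    rw [← hd]
  · rw [hndvd hq]
    field_simp
  · simp [hdvd hq]

/-- The exponent relating `PX` and `PstarX`. -/
theorem exists_PX_eq_PstarX_mul_exp {q : ℕ} [NeZero q] (χ : DirichletCharacter ℂ q) {s : ℂ}
    (hs : 1 / 2 ≤ s.re) {X : ℝ} (hX : (q : ℝ) ^ 2 < X) :
    ∃ D : ℂ, PX X χ s = PstarX X χ s * Complex.exp D ∧
      ‖D‖ ≤ (∑ p ∈ primesUpTo X, errBound X p) / Real.log X := by
  have hX0 : 0 ≤ X := (sq_nonneg _).trans hX.le
  choose! d hd hdn using fun p (hp : p ∈ primesUpTo X) => exists_local_factor_eq χ hs hX hp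
  refine ⟨∑ p ∈ primesUpTo X, d p, ?_, ?_⟩
  · have hsub : (primesUpTo X).filter (· ∣ q) = q.primeFactors := by
      ext p
      simp only [Finset.mem_filter, mem_primesUpTo, Nat.mem_primeFactors]
      refine ⟨fun h => ⟨h.1.1, h.2, NeZero.ne q⟩, fun h => ⟨⟨h.1, ?_⟩, h.2.1⟩⟩
      have h1 : (p : ℝ) ≤ q := by exact_mod_cast Nat.le_of_dvd (NeZero.pos q) h.2.1
      have h2 : (1 : ℝ) ≤ q := by exact_mod_cast NeZero.one_le
      nlinarith
    rw [PX, PstarX, sum_natsUpTo_eq_sum_primesUpTo hX0, ← hsub, Finset.prod_filter,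
      Finset.prod_filter, Complex.exp_sum, Complex.exp_sum, ← Finset.prod_mul_distrib,
      ← Finset.prod_mul_distrib, ← Finset.prod_mul_distrib]
    · refine Finset.prod_congr rfl fun p hp => ?_
      rw [← hd p hp]
      congr 2
      refine Finset.sum_congr rfl fun k hk => ?_
      exact prime_pow_term_eq _ s (mem_primesUpTo.1 hp).1 (by grind)
    · intro n hn
      simp [ArithmeticFunction.vonMangoldt_eq_zero_iff.2 hn]
  · rw [Finset.sum_div]
    exact norm_sum_le_of_le _ hdn

theorem norm_exp_sub_one_le_mul_exp (z : ℂ) : ‖Complex.exp z - 1‖ ≤ ‖z‖ * Real.exp ‖z‖ := by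
  simpa using Complex.norm_exp_sub_sum_le_norm_mul_exp z 1

/-- Uniformly for `Re s ≥ 1/2` and `X > q²`,
`𝓟_X^ℓ(s) = 𝓟*_X^ℓ(s)(1 + O_k(1/log X))`, where the implied constant depends only on `k`. -/
theorem PXl_eq_PstarXl (k : ℕ) :
    ∃ C : ℝ, ∀ (q : ℕ) [NeZero q], ∀ ℓ : DirichletCharacter ℂ q → ℕ,
      (∑ χ : DirichletCharacter ℂ q, ℓ χ = k) →
      ∀ s : ℂ, 1/2 ≤ s.re → ∀ X : ℝ, (q : ℝ) ^ 2 < X →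
        ∃ E : ℂ, ‖E‖ ≤ C / Real.log X ∧ PXl X ℓ s = PstarXl X ℓ s * (1 + E) := by
  set B : ℝ := ∑' n : ℕ, 24 * (n : ℝ) ^ (-(5 / 4) : ℝ) + 4 * Real.log 4
  have hB0 : 0 ≤ B := add_nonneg (tsum_nonneg fun n => by positivity)
    (mul_nonneg (by norm_num) (Real.log_nonneg (by norm_num)))
  refine ⟨k * B * Real.exp (k * B / Real.log 2), fun q _ ℓ hℓ s hs X hX => ?_⟩
  have hq : (1 : ℝ) ≤ q := by exact_mod_cast NeZero.one_le
  have hX1 : 1 < X := by nlinarith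
  have hlogX : 0 < Real.log X := Real.log_pos hX1
  choose D hD hDn using fun χ : DirichletCharacter ℂ q => exists_PX_eq_PstarX_mul_exp χ hs hX
  set S := ∑ p ∈ primesUpTo X, errBound X p with hS
  set Δ := ∑ χ : DirichletCharacter ℂ q, (ℓ χ : ℂ) * D χ with hΔ
  have hΔn : ‖Δ‖ ≤ k * (S / Real.log X) := by
    rw [← hℓ, Nat.cast_sum, Finset.sum_mul]
    refine norm_sum_le_of_le _ fun χ _ => ?_
    rw [norm_mul, Complex.norm_natCast]
    exact mul_le_mul_of_nonneg_left (hDn χ) (Nat.cast_nonneg _)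
  refine ⟨Complex.exp Δ - 1, (norm_exp_sub_one_le_mul_exp Δ).trans ?_, ?_⟩
  · rcases lt_or_ge X 2 with h2 | h2
    · have hempty : primesUpTo X = ∅ := by
        refine Finset.eq_empty_of_forall_notMem fun p hp => ?_
        obtain ⟨hp, hpX⟩ := mem_primesUpTo.1 hp
        have : (2 : ℝ) ≤ p := by exact_mod_cast hp.two_le
        linarith
      have hΔ0 : ‖Δ‖ = 0 := le_antisymm (by simpa [hS, hempty] using hΔn) (norm_nonneg _)
      rw [hΔ0, zero_mul]
      positivity
    · have hSB : S ≤ B := sum_errBound_le (by linarith)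
      have hlog2 : 0 < Real.log 2 := Real.log_pos (by norm_num)
      have hΔB : ‖Δ‖ ≤ k * B / Real.log X := by
        rw [mul_div_assoc]
        exact hΔn.trans (by gcongr)
      have hΔB' : ‖Δ‖ ≤ k * B / Real.log 2 := hΔB.trans (by gcongr)
      calc ‖Δ‖ * Real.exp ‖Δ‖ ≤ k * B / Real.log X * Real.exp (k * B / Real.log 2) := by gcongr
        _ = _ := by ring
  · rw [add_sub_cancel, PXl, PstarXl, hΔ, Complex.exp_sum, ← Finset.prod_mul_distrib]
    refine Finset.prod_congr rfl fun χ _ => ?_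
    rw [hD, mul_pow, Complex.exp_nat_mul]
end

section
/- Let q ≥ 1 and c be integers with gcd(c,q) = 1, and let κ be a fixed real number. Then the limit P_c = lim_{Y→∞} ∏_{p ≤ Y} (1 − 1/p)^{1 − δ_q(p,c)·φ(q)} over primes p exists in (0,∞), where δ_q(p,c) = 1 if p ≡ c (mod q) and 0 otherwise and φ is Euler's totient function; moreover there is a constant C depending on q and κ such that for all X ≥ 3: ∏_{p ≤ X, p ≡ c (mod q)} (1 − 1/p)^{−κ} = (e^γ · P_c · log X)^{κ/φ(q)} · (1 + E) with |E| ≤ C/log X, where γ is the Euler–Mascheroni constant. -/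
open Complex Filter MeasureTheory Finset HurwitzZeta
open scoped ArithmeticFunction Real Classical

section PartialSummation

variable {E : Type*} [NormedAddCommGroup E] [NormedSpace ℝ E]

lemma sum_Ico_smul_by_parts (f : ℕ → ℝ) (b : ℕ → E) {M N : ℕ} (h : M ≤ N) :
    ∑ i ∈ Ico M N, f i • b i = f N • ∑ i ∈ range N, b i - f M • ∑ i ∈ range M, b i
      + ∑ i ∈ Ico M N, (f i - f (i + 1)) • ∑ j ∈ range (i + 1), b j := by
  induction N, h using Nat.le_induction with
  | base => simp
  | succ N h ih =>
    rw [sum_Ico_succ_top h, ih, sum_Ico_succ_top h, sum_range_succ]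
    module

/-- Dirichlet's test, with an explicit bound. -/
lemma norm_sum_Ico_smul_le {f : ℕ → ℝ} {b : ℕ → E} {C : ℝ} {M : ℕ}
    (hb : ∀ n, ‖∑ i ∈ range n, b i‖ ≤ C) (hf : ∀ i ≥ M, f (i + 1) ≤ f i)
    (hf0 : ∀ i ≥ M, 0 ≤ f i) (N : ℕ) :
    ‖∑ i ∈ Ico M N, f i • b i‖ ≤ 2 * C * f M := by
  have hC : 0 ≤ C := (norm_nonneg _).trans (hb 0)
  rcases lt_or_ge N M with h | h
  · rw [Ico_eq_empty_of_le h.le]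
    have := hf0 M le_rfl
    simp only [sum_empty, norm_zero]
    positivity
  rw [sum_Ico_smul_by_parts f b h]
  have h1 : ‖f N • ∑ i ∈ range N, b i‖ ≤ f N * C := by
    rw [norm_smul, Real.norm_of_nonneg (hf0 N h)]
    exact mul_le_mul_of_nonneg_left (hb N) (hf0 N h)
  have h2 : ‖f M • ∑ i ∈ range M, b i‖ ≤ f M * C := by
    rw [norm_smul, Real.norm_of_nonneg (hf0 M le_rfl)]
    exact mul_le_mul_of_nonneg_left (hb M) (hf0 M le_rfl)
  have h3 : ‖∑ i ∈ Ico M N, (f i - f (i + 1)) • ∑ j ∈ range (i + 1), b j‖ ≤ (f M - f N) * C := by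
    have h4 : f M - f N = ∑ i ∈ Ico M N, (f i - f (i + 1)) := by
      rw [← neg_inj, ← sum_neg_distrib]
      simp only [neg_sub]
      rw [sum_Ico_sub f h]
    rw [h4, sum_mul]
    refine norm_sum_le_of_le _ fun i hi => ?_
    have hi' := hf i (mem_Ico.mp hi).1
    rw [norm_smul, Real.norm_of_nonneg (by linarith)]
    exact mul_le_mul_of_nonneg_left (hb _) (by linarith)
  have := norm_add_le (f N • ∑ i ∈ range N, b i - f M • ∑ i ∈ range M, b i)
    (∑ i ∈ Ico M N, (f i - f (i + 1)) • ∑ j ∈ range (i + 1), b j)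
  have := norm_sub_le (f N • ∑ i ∈ range N, b i) (f M • ∑ i ∈ range M, b i)
  linarith

/-- Dirichlet's test, with an explicit rate of convergence. -/
lemma exists_norm_sum_range_smul_sub_le [CompleteSpace E] {f : ℕ → ℝ} {b : ℕ → E} {C : ℝ} {M : ℕ}
    (hb : ∀ n, ‖∑ i ∈ range n, b i‖ ≤ C) (hf : ∀ i ≥ M, f (i + 1) ≤ f i)
    (hf0 : ∀ i ≥ M, 0 ≤ f i) (hlim : Tendsto f atTop (nhds 0)) :
    ∃ L : E, ∀ N ≥ M, ‖∑ i ∈ range N, f i • b i - L‖ ≤ 2 * C * f N := by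
  have key : ∀ N ≥ M, ∀ N' ≥ N,
      ‖∑ i ∈ range N, f i • b i - ∑ i ∈ range N', f i • b i‖ ≤ 2 * C * f N := by
    intro N hN N' hN'
    rw [norm_sub_rev, ← sum_Ico_eq_sub _ hN']
    exact norm_sum_Ico_smul_le hb (fun i hi => hf i (hN.trans hi))
      (fun i hi => hf0 i (hN.trans hi)) N'
  have hc : CauchySeq fun N => ∑ i ∈ range (N + M), f i • b i := by
    refine cauchySeq_of_le_tendsto_0' (fun N => 2 * C * f (N + M)) ?_ ?_
    · intro n m hnm
      rw [dist_eq_norm]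
      exact key _ (by omega) _ (by omega)
    · simpa using ((tendsto_add_atTop_iff_nat M).mpr hlim).const_mul (2 * C)
  obtain ⟨L, hL⟩ := cauchySeq_tendsto_of_complete hc
  rw [tendsto_add_atTop_iff_nat (f := fun N => ∑ i ∈ range N, f i • b i) M] at hL
  refine ⟨L, fun N hN => ?_⟩
  refine le_of_tendsto (hL.const_sub _).norm ?_
  filter_upwards [eventually_ge_atTop N] with N' hN' using key N hN N' hN'

end PartialSummation

lemma abs_sum_le_tsum_abs {f : ℕ → ℝ} (hf : Summable fun n => |f n|) (s : Finset ℕ) :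
    |∑ n ∈ s, f n| ≤ ∑' n, |f n| :=
  (abs_sum_le_sum_abs _ _).trans (hf.sum_le_tsum s fun _ _ => abs_nonneg _)

lemma sum_range_succ_eq_sum_Ioc {A : Type*} [AddCommMonoid A] {f : ℕ → A} (h0 : f 0 = 0) (N : ℕ) :
    ∑ n ∈ range (N + 1), f n = ∑ n ∈ Ioc 0 N, f n := by
  rw [sum_range_succ', h0, add_zero, range_eq_Ico, sum_Ico_add' f 0 N 1]
  rfl

lemma summable_vonMangoldt_div_of_not_prime :
    Summable fun n : ℕ => (if n.Prime then 0 else Λ n / n : ℝ) := by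
  refine (ArithmeticFunction.vonMangoldt.summable_residueClass_non_primes_div
    (q := 1) 0).congr fun n => ?_
  have : (n : ZMod 1) = 0 := Subsingleton.elim _ _
  split_ifs <;> simp [ArithmeticFunction.vonMangoldt.residueClass, this]

lemma sum_log_eq_sum_vonMangoldt_mul (N : ℕ) :
    ∑ n ∈ Ioc 0 N, Real.log n = ∑ n ∈ Ioc 0 N, Λ n * ((N / n : ℕ) : ℝ) := by
  rw [← ArithmeticFunction.sum_Ioc_mul_zeta_eq_sum, ArithmeticFunction.vonMangoldt_mul_zeta]
  rfl

lemma sum_Ioc_log_eq (N : ℕ) : ∑ n ∈ Ioc 0 N, Real.log n = Real.log (N.factorial) := by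
  induction N with
  | zero => simp
  | succ N ih =>
    rw [← sum_range_succ_eq_sum_Ioc (by simp), sum_range_succ, sum_range_succ_eq_sum_Ioc (by simp),
      ih, Nat.factorial_succ, Nat.cast_mul, Real.log_mul (by positivity) (by positivity), add_comm]

/-- Mertens' first theorem, for the von Mangoldt function. -/
lemma exists_abs_sum_vonMangoldt_div_sub_log_le :
    ∃ C : ℝ, ∀ N : ℕ, |∑ n ∈ Ioc 0 N, Λ n / n - Real.log N| ≤ C := by
  refine ⟨(Real.log 4 + 4) + 1, fun N => ?_⟩
  have hlog4 : 0 < Real.log 4 := Real.log_pos (by norm_num)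
  rcases Nat.eq_zero_or_pos N with rfl | hN
  · simp; positivity
  have hN' : (0 : ℝ) < N := by exact_mod_cast hN
  have hup : Real.log N.factorial ≤ N * ∑ n ∈ Ioc 0 N, Λ n / n := by
    rw [← sum_Ioc_log_eq, sum_log_eq_sum_vonMangoldt_mul, mul_sum]
    refine sum_le_sum fun n _ => ?_
    have := mul_le_mul_of_nonneg_left (Nat.cast_div_le (m := N) (n := n) (α := ℝ))
      (ArithmeticFunction.vonMangoldt_nonneg (n := n))
    calc _ ≤ _ := this
      _ = _ := by ring
  have hpsi : ∑ n ∈ Ioc 0 N, Λ n ≤ (Real.log 4 + 4) * N := by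
    have := Chebyshev.psi_le_const_mul_self (x := N) hN'.le
    rwa [Chebyshev.psi, Nat.floor_natCast] at this
  have hlow : N * ∑ n ∈ Ioc 0 N, Λ n / n - ∑ n ∈ Ioc 0 N, Λ n ≤ Real.log N.factorial := by
    rw [← sum_Ioc_log_eq, sum_log_eq_sum_vonMangoldt_mul, mul_sum, ← sum_sub_distrib]
    refine sum_le_sum fun n _ => ?_
    have h1 : (N / n : ℝ) - 1 ≤ ((N / n : ℕ) : ℝ) := by
      rw [← Nat.floor_div_eq_div (K := ℝ)]
      have := Nat.lt_floor_add_one ((N : ℝ) / n)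
      linarith
    have := mul_le_mul_of_nonneg_left h1 (ArithmeticFunction.vonMangoldt_nonneg (n := n))
    calc _ = _ := by ring
      _ ≤ _ := this
  have hfac_le : Real.log N.factorial ≤ N * Real.log N := by
    rw [← Real.log_pow]
    exact Real.log_le_log (by positivity) (by exact_mod_cast Nat.factorial_le_pow N)
  have hle_fac : N * Real.log N - N ≤ Real.log N.factorial := by
    have := Real.pow_div_factorial_le_exp (x := N) hN'.le N
    have := Real.log_le_log (by positivity) this
    rw [Real.log_exp, Real.log_div (by positivity) (by positivity), Real.log_pow] at this
    linarith
  rw [abs_le]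
  constructor
  · refine le_of_mul_le_mul_left ?_ hN'
    nlinarith
  · refine le_of_mul_le_mul_left ?_ hN'
    nlinarith

/-- Mertens' first theorem. -/
lemma exists_abs_sum_prime_log_div_sub_log_le :
    ∃ C : ℝ, ∀ N : ℕ,
      |∑ n ∈ range N, (if n.Prime then Real.log n / n else 0) - Real.log N| ≤ C := by
  obtain ⟨C, hC⟩ := exists_abs_sum_vonMangoldt_div_sub_log_le
  have hs := summable_vonMangoldt_div_of_not_prime.abs
  refine ⟨C + (∑' n : ℕ, |(if n.Prime then 0 else Λ n / n : ℝ)|) + 1, fun N => ?_⟩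
  have hT : 0 ≤ ∑' n : ℕ, |(if n.Prime then 0 else Λ n / n : ℝ)| :=
    tsum_nonneg fun _ => abs_nonneg _
  have hC0 : 0 ≤ C := (abs_nonneg _).trans (hC 0)
  rcases N with _ | N
  · simp; positivity
  have h1 : ∑ n ∈ range (N + 1), (if n.Prime then Real.log n / n else 0)
      = ∑ n ∈ Ioc 0 N, Λ n / n - ∑ n ∈ range (N + 1), (if n.Prime then 0 else Λ n / n : ℝ) := by
    rw [← sum_range_succ_eq_sum_Ioc (by simp), ← sum_sub_distrib]
    refine sum_congr rfl fun n _ => ?_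
    split_ifs with h
    · rw [ArithmeticFunction.vonMangoldt_apply_prime h, sub_zero]
    · ring
  have h2 := abs_sum_le_tsum_abs hs (range (N + 1))
  have h3 := hC N
  have h4 : |Real.log N - Real.log (N + 1 : ℕ)| ≤ 1 := by
    rcases Nat.eq_zero_or_pos N with rfl | hN
    · simp
    have hN' : (1 : ℝ) ≤ N := by exact_mod_cast hN
    have h5 : Real.log N ≤ Real.log (N + 1 : ℕ) :=
      Real.log_le_log (by positivity) (by push_cast; linarith)
    have h6 := Real.log_le_sub_one_of_pos (x := (N + 1 : ℕ) / N) (by positivity)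
    rw [Real.log_div (by positivity) (by positivity)] at h6
    have h7 : ((N + 1 : ℕ) : ℝ) / N - 1 ≤ 1 := by
      rw [sub_le_iff_le_add, div_le_iff₀ (by positivity)]; push_cast; linarith
    rw [abs_le]; constructor <;> linarith
  rw [h1]
  rw [abs_le] at *
  constructor <;> linarith [h2.1, h2.2, h3.1, h3.2, h4.1, h4.2]

lemma log_succ_sub_log_le (n : ℕ) (hn : 1 ≤ n) : Real.log (n + 1) - Real.log n ≤ 1 / n := by
  have hn' : (1 : ℝ) ≤ n := by exact_mod_cast hn
  have h6 := Real.log_le_sub_one_of_pos (x := (n + 1) / n) (by positivity)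
  rw [Real.log_div (by positivity) (by positivity)] at h6
  have h7 : ((n : ℝ) + 1) / n - 1 = 1 / n := by field_simp; ring
  linarith

lemma abs_log_sub_log_mul_loglog_le (n : ℕ) :
    |(Real.log (n + 1) - Real.log n)
      - Real.log n * (Real.log (Real.log (n + 1)) - Real.log (Real.log n))| ≤ 1 / (n : ℝ) ^ 2 := by
  rcases Nat.lt_or_ge n 2 with h | h
  · interval_cases n
    · simp
    · have := log_succ_sub_log_le 1 le_rfl
      have h2 : 0 ≤ Real.log (1 + 1) := Real.log_nonneg (by norm_num)
      norm_num at this h2 ⊢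
      rw [abs_of_nonneg h2]
      exact this
  have hn : (2 : ℝ) ≤ n := by exact_mod_cast h
  have hl : 0 < Real.log n := Real.log_pos (by linarith)
  have hle : Real.log n ≤ Real.log (n + 1) := Real.log_le_log (by linarith) (by linarith)
  have hl' : 1 ≤ Real.log (n + 1) := by
    rw [Real.le_log_iff_exp_le (by linarith)]
    have := Real.exp_one_lt_d9
    linarith
  have hd := log_succ_sub_log_le n (by omega)
  set a := Real.log n
  set b := Real.log (n + 1)
  have hup : Real.log b - Real.log a ≤ b / a - 1 := by
    rw [← Real.log_div (by linarith) hl.ne']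
    exact Real.log_le_sub_one_of_pos (by positivity)
  have hlow : 1 - a / b ≤ Real.log b - Real.log a := by
    have := Real.log_le_sub_one_of_pos (x := a / b) (by positivity)
    rw [Real.log_div hl.ne' (by linarith)] at this
    linarith
  have h1 : a * (Real.log b - Real.log a) ≤ b - a := by
    have := mul_le_mul_of_nonneg_left hup hl.le
    rwa [mul_sub a (b / a), mul_div_cancel₀ _ hl.ne', mul_one] at this
  have h2 : (b - a) - (b - a) ^ 2 ≤ a * (Real.log b - Real.log a) := by
    have h3 := mul_le_mul_of_nonneg_left hlow hl.le
    have h4 : a * (1 - a / b) = (b - a) - (b - a) ^ 2 / b := by field_simp; ring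
    have h5 : (b - a) ^ 2 / b ≤ (b - a) ^ 2 := div_le_self (sq_nonneg _) hl'
    linarith
  have h6 : (b - a) ^ 2 ≤ (1 / n) ^ 2 := pow_le_pow_left₀ (by linarith) hd 2
  rw [div_pow, one_pow] at h6
  rw [abs_of_nonneg (by linarith)]
  linarith

lemma tendsto_inv_log_natCast : Tendsto (fun n : ℕ => (Real.log n)⁻¹) atTop (nhds 0) :=
  tendsto_inv_atTop_zero.comp (Real.tendsto_log_atTop.comp tendsto_natCast_atTop_atTop)

lemma inv_log_succ_le {n : ℕ} (hn : 2 ≤ n) : (Real.log (n + 1 : ℕ))⁻¹ ≤ (Real.log n)⁻¹ := by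
  have hn : (2 : ℝ) ≤ n := by exact_mod_cast hn
  apply inv_anti₀ (Real.log_pos (by linarith))
  exact Real.log_le_log (by linarith) (by push_cast; linarith)

lemma sum_range_loglog_sub {N : ℕ} (hN : 2 ≤ N) :
    ∑ n ∈ range N, (Real.log n)⁻¹ *
        (Real.log n * (Real.log (Real.log (n + 1)) - Real.log (Real.log n)))
      = Real.log (Real.log N) - Real.log (Real.log 2) := by
  induction N, hN using Nat.le_induction with
  | base => simp [sum_range_succ]
  | succ N hN ih =>
    have hN : (2 : ℝ) ≤ N := by exact_mod_cast hN
    have := Real.log_pos (x := N) (by linarith)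
    rw [sum_range_succ, ih, inv_mul_cancel_left₀ this.ne']
    push_cast
    ring

/-- Mertens' second theorem, along the naturals. -/
lemma exists_abs_sum_range_prime_inv_sub_le :
    ∃ M C : ℝ, ∀ N : ℕ, 2 ≤ N →
      |∑ n ∈ range N, (if n.Prime then 1 / n else 0 : ℝ) - Real.log (Real.log N) - M|
        ≤ C / Real.log N := by
  obtain ⟨C, hC⟩ := exists_abs_sum_prime_log_div_sub_log_le
  have hs : Summable fun n : ℕ => 1 / (n : ℝ) ^ 2 := Real.summable_one_div_nat_pow.mpr (by norm_num)
  set c : ℕ → ℝ := fun n => Real.log n * (Real.log (Real.log (n + 1)) - Real.log (Real.log n))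
  set b : ℕ → ℝ := fun n => (if n.Prime then Real.log n / n else 0) - c n with hbdef
  have hb : ∀ N, ‖∑ i ∈ range N, b i‖ ≤ C + ∑' n : ℕ, 1 / (n : ℝ) ^ 2 := by
    intro N
    have h1 : ∑ i ∈ range N, b i =
        (∑ n ∈ range N, (if n.Prime then Real.log n / n else 0) - Real.log N)
        + ∑ n ∈ range N, ((Real.log (n + 1) - Real.log n) - c n) := by
      have := sum_range_sub (fun n : ℕ => Real.log n) N
      push_cast at this
      simp only [hbdef, sum_sub_distrib] at this ⊢
      rw [this]
      simp
    rw [h1]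
    refine (norm_add_le _ _).trans (add_le_add (hC N) ?_)
    refine (norm_sum_le_of_le _ fun n _ => abs_log_sub_log_mul_loglog_le n).trans ?_
    exact hs.sum_le_tsum _ fun _ _ => by positivity
  obtain ⟨L, hL⟩ := exists_norm_sum_range_smul_sub_le (f := fun n : ℕ => (Real.log n)⁻¹) (M := 2) hb
    (fun i hi => inv_log_succ_le hi) (fun i _ => inv_nonneg.mpr (Real.log_natCast_nonneg i))
    tendsto_inv_log_natCast
  refine ⟨L - Real.log (Real.log 2), 2 * (C + ∑' n : ℕ, 1 / (n : ℝ) ^ 2), fun N hN => ?_⟩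
  have h2 : ∑ i ∈ range N, (Real.log i)⁻¹ • b i =
      ∑ n ∈ range N, (if n.Prime then 1 / n else 0 : ℝ)
        - (Real.log (Real.log N) - Real.log (Real.log 2)) := by
    rw [← sum_range_loglog_sub hN, ← sum_sub_distrib]
    refine sum_congr rfl fun n _ => ?_
    simp only [hbdef, smul_eq_mul]
    rw [mul_sub]
    congr 1
    split_ifs with hp
    · have := Real.log_pos (x := n) (by exact_mod_cast hp.one_lt)
      field_simp
    · simp
  have h3 := hL N hN
  rw [h2, Real.norm_eq_abs] at h3
  calc _ = |_| := by congr 1; ring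
    _ ≤ _ := h3
    _ = _ := by rw [div_eq_mul_inv]

lemma abs_loglog_floor_succ_sub_le {X : ℝ} (hX : 2 ≤ X) :
    |Real.log (Real.log (⌊X⌋₊ + 1 : ℕ)) - Real.log (Real.log X)| ≤ 1 / Real.log X := by
  have h1 : X ≤ (⌊X⌋₊ + 1 : ℕ) := by push_cast; exact (Nat.lt_floor_add_one X).le
  have h2 : ((⌊X⌋₊ + 1 : ℕ) : ℝ) ≤ X + 1 := by
    push_cast
    linarith [Nat.floor_le (by linarith : 0 ≤ X)]
  have hl : 0 < Real.log X := Real.log_pos (by linarith)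
  have h3 : Real.log X ≤ Real.log (⌊X⌋₊ + 1 : ℕ) := Real.log_le_log (by linarith) h1
  have h4 : Real.log (⌊X⌋₊ + 1 : ℕ) - Real.log X ≤ 1 := by
    have := Real.log_le_sub_one_of_pos (x := (⌊X⌋₊ + 1 : ℕ) / X) (by positivity)
    rw [Real.log_div (by positivity) (by positivity)] at this
    have h7 : ((⌊X⌋₊ + 1 : ℕ) : ℝ) / X - 1 ≤ 1 := by
      rw [sub_le_iff_le_add, div_le_iff₀ (by positivity)]; linarith
    linarith
  have h5 := Real.log_le_sub_one_of_pos (x := Real.log (⌊X⌋₊ + 1 : ℕ) / Real.log X)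
    (div_pos (by linarith) hl)
  rw [Real.log_div (by linarith) (by positivity)] at h5
  have h6 := Real.log_le_log hl h3
  rw [abs_of_nonneg (by linarith)]
  refine h5.trans ?_
  rw [sub_le_iff_le_add, div_add_one hl.ne']
  gcongr
  linarith

lemma inv_log_floor_succ_le {X : ℝ} (hX : 2 ≤ X) :
    (Real.log (⌊X⌋₊ + 1 : ℕ))⁻¹ ≤ (Real.log X)⁻¹ := by
  apply inv_anti₀ (Real.log_pos (by linarith))
  exact Real.log_le_log (by linarith) (by push_cast; exact (Nat.lt_floor_add_one X).le)

/-- Mertens' second theorem. -/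
lemma exists_abs_sum_prime_inv_sub_le :
    ∃ M C : ℝ, ∀ X : ℝ, 2 ≤ X →
      |∑ n ∈ range (⌊X⌋₊ + 1), (if n.Prime then 1 / n else 0 : ℝ) - Real.log (Real.log X) - M|
        ≤ C / Real.log X := by
  obtain ⟨M, C, hC⟩ := exists_abs_sum_range_prime_inv_sub_le
  refine ⟨M, |C| + 1, fun X hX => ?_⟩
  have hfl : 2 ≤ ⌊X⌋₊ := Nat.le_floor (by exact_mod_cast hX)
  have h1 := hC (⌊X⌋₊ + 1) (by omega)
  have h2 := abs_loglog_floor_succ_sub_le hX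
  have h3 : C / Real.log (⌊X⌋₊ + 1 : ℕ) ≤ |C| / Real.log X := by
    rw [div_eq_mul_inv, div_eq_mul_inv]
    exact mul_le_mul (le_abs_self C) (inv_log_floor_succ_le hX)
      (inv_nonneg.mpr (Real.log_natCast_nonneg _)) (abs_nonneg C)
  rw [add_div]
  rw [abs_le] at *
  constructor <;> linarith [h1.1, h1.2, h2.1, h2.2]

/-- An Abelian theorem for Laplace transforms. -/
lemma tendsto_integral_comp_inv_mul_mul_exp_neg {D : ℝ → ℝ} {B L : ℝ} (hm : Measurable D)
    (hB : ∀ u, 0 < u → |D u| ≤ B) (hL : Tendsto D atTop (nhds L)) :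
    Tendsto (fun ε : ℝ => ∫ t in Set.Ioi (0 : ℝ), D (ε⁻¹ * t) * Real.exp (-t))
      (nhdsWithin 0 (Set.Ioi 0)) (nhds L) := by
  have h1 : L = ∫ t in Set.Ioi (0 : ℝ), L * Real.exp (-t) := by
    rw [integral_const_mul, integral_exp_neg_Ioi_zero, mul_one]
  rw [h1]
  refine tendsto_integral_filter_of_dominated_convergence (fun t => B * Real.exp (-t)) ?_ ?_ ?_ ?_
  · refine Eventually.of_forall fun ε => Measurable.aestronglyMeasurable ?_
    fun_prop
  · filter_upwards [self_mem_nhdsWithin] with ε hε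
    refine (ae_restrict_iff' measurableSet_Ioi).mpr (Eventually.of_forall fun t ht => ?_)
    rw [norm_mul, Real.norm_of_nonneg (Real.exp_pos _).le]
    exact mul_le_mul_of_nonneg_right
      (hB _ (mul_pos (inv_pos.mpr (Set.mem_Ioi.mp hε)) (Set.mem_Ioi.mp ht))) (Real.exp_pos _).le
  · exact (integrableOn_exp_neg_Ioi 0).const_mul B
  · refine (ae_restrict_iff' measurableSet_Ioi).mpr (Eventually.of_forall fun t ht => ?_)
    refine Tendsto.mul_const _ (hL.comp ?_)
    exact tendsto_inv_nhdsGT_zero.atTop_mul_const (Set.mem_Ioi.mp ht)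

lemma integrableOn_ite_exp_neg (w a : ℝ) :
    IntegrableOn (fun t : ℝ => if a ≤ t then w * Real.exp (-t) else 0) (Set.Ioi 0) := by
  have h : (fun t : ℝ => if a ≤ t then w * Real.exp (-t) else 0)
      = (Set.Ici a).indicator (fun t => w * Real.exp (-t)) := by
    ext t; simp [Set.indicator_apply]
  rw [h]
  exact ((integrableOn_exp_neg_Ioi 0).const_mul w).indicator measurableSet_Ici

lemma integral_ite_exp_neg (w : ℝ) {a : ℝ} (ha : 0 ≤ a) :
    ∫ t in Set.Ioi (0 : ℝ), (if a ≤ t then w * Real.exp (-t) else 0) = w * Real.exp (-a) := by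
  have h : (fun t : ℝ => if a ≤ t then w * Real.exp (-t) else 0)
      = (Set.Ici a).indicator (fun t => w * Real.exp (-t)) := by
    ext t; simp [Set.indicator_apply]
  rw [h, integral_indicator measurableSet_Ici, Measure.restrict_restrict measurableSet_Ici]
  have h2 : ((Set.Ici a ∩ Set.Ioi 0 : Set ℝ)) =ᵐ[volume] Set.Ioi a := by
    have h3 : (Set.Ioi a : Set ℝ) ∩ Set.Ioi 0 = Set.Ioi a := by
      rw [Set.Ioi_inter_Ioi, max_eq_left ha]
    conv_rhs => rw [← h3]
    exact Ioi_ae_eq_Ici.symm.inter (ae_eq_refl _)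
  rw [Measure.restrict_congr_set h2, integral_const_mul, integral_exp_neg_Ioi]

/-- A difference of two generalized Dirichlet series as a Laplace transform. -/
lemma hasSum_mul_exp_neg_sub {w v a b : ℕ → ℝ} (ha : ∀ n, 0 ≤ a n) (hb : ∀ n, 0 ≤ b n)
    (hw0 : ∀ n, 0 ≤ w n) (hv0 : ∀ n, 0 ≤ v n)
    (hw : Summable fun n => w n * Real.exp (-a n)) (hv : Summable fun n => v n * Real.exp (-b n)) :
    HasSum (fun n => w n * Real.exp (-a n) - v n * Real.exp (-b n))
      (∫ t in Set.Ioi (0 : ℝ), ∑' n, ((if a n ≤ t then w n * Real.exp (-t) else 0)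
        - (if b n ≤ t then v n * Real.exp (-t) else 0))) := by
  have key := hasSum_integral_of_summable_integral_norm (μ := volume.restrict (Set.Ioi (0 : ℝ)))
    (F := fun n t => (if a n ≤ t then w n * Real.exp (-t) else 0)
        - (if b n ≤ t then v n * Real.exp (-t) else 0))
    (fun n => (integrableOn_ite_exp_neg _ _).sub (integrableOn_ite_exp_neg _ _)) ?_
  · have e : (fun n => w n * Real.exp (-a n) - v n * Real.exp (-b n)) = fun n =>
        ∫ t in Set.Ioi (0 : ℝ), ((if a n ≤ t then w n * Real.exp (-t) else 0)
          - (if b n ≤ t then v n * Real.exp (-t) else 0)) := by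
      funext n
      rw [integral_sub (integrableOn_ite_exp_neg _ _) (integrableOn_ite_exp_neg _ _),
        integral_ite_exp_neg _ (ha n), integral_ite_exp_neg _ (hb n)]
    rw [e]
    exact key
  · refine Summable.of_nonneg_of_le (fun n => integral_nonneg fun t => norm_nonneg _) (fun n => ?_)
      (hw.add hv)
    rw [← integral_ite_exp_neg (w n) (ha n), ← integral_ite_exp_neg (v n) (hb n),
      ← integral_add (integrableOn_ite_exp_neg _ _) (integrableOn_ite_exp_neg _ _)]
    refine integral_mono
      ((integrableOn_ite_exp_neg _ _).sub (integrableOn_ite_exp_neg _ _)).norm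
      ((integrableOn_ite_exp_neg _ _).add (integrableOn_ite_exp_neg _ _)) fun t => ?_
    refine (norm_sub_le _ _).trans (add_le_add (le_of_eq ?_) (le_of_eq ?_)) <;>
    · refine Real.norm_of_nonneg ?_
      split_ifs
      · have := hw0 n
        have := hv0 n
        positivity
      · exact le_rfl

lemma neg_log_one_sub_sub_bounds {x : ℝ} (h1 : x ≤ 1 / 2) :
    0 ≤ -Real.log (1 - x) - x ∧ -Real.log (1 - x) - x ≤ 2 * x ^ 2 := by
  constructor
  · have := Real.log_le_sub_one_of_pos (x := 1 - x) (by linarith)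
    linarith
  · have := Real.one_sub_inv_le_log_of_pos (x := 1 - x) (by linarith)
    have h2 : (1 - x)⁻¹ ≤ 1 + x + 2 * x ^ 2 := by
      rw [inv_le_iff_one_le_mul₀ (by linarith)]
      nlinarith [mul_nonneg (sq_nonneg x) (by linarith : (0 : ℝ) ≤ 1 / 2 - x)]
    linarith

lemma rpow_neg_le_half {p : ℕ} (hp : p.Prime) {s : ℝ} (hs : 1 ≤ s) :
    (p : ℝ) ^ (-s) ≤ 1 / p ∧ (1 : ℝ) / p ≤ 1 / 2 := by
  have h2 : (2 : ℝ) ≤ p := by exact_mod_cast hp.two_le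
  constructor
  · rw [one_div, ← Real.rpow_neg_one]
    exact Real.rpow_le_rpow_of_exponent_le (by linarith) (by linarith)
  · exact one_div_le_one_div_of_le (by norm_num) h2

/-- The contribution of higher prime powers to `log ζ(s)`. -/
lemma abs_ite_prime_neg_log_sub_le (n : ℕ) {s : ℝ} (hs : 1 ≤ s) :
    |if n.Prime then -Real.log (1 - (n : ℝ) ^ (-s)) - (n : ℝ) ^ (-s) else 0|
      ≤ 2 * (1 / (n : ℝ) ^ 2) := by
  split_ifs with hp
  · obtain ⟨h1, h2⟩ := rpow_neg_le_half hp hs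
    have h0 : 0 ≤ (n : ℝ) ^ (-s) := by positivity
    obtain ⟨h3, h4⟩ := neg_log_one_sub_sub_bounds (h1.trans h2)
    rw [abs_of_nonneg h3]
    refine h4.trans ?_
    have := pow_le_pow_left₀ h0 h1 2
    rw [div_pow, one_pow] at this
    linarith
  · simp

lemma summable_two_mul_one_div_sq : Summable fun n : ℕ => 2 * (1 / (n : ℝ) ^ 2) :=
  (Real.summable_one_div_nat_pow.mpr (by norm_num)).mul_left 2

lemma tendsto_tsum_prime_neg_log_sub :
    Tendsto (fun s : ℝ => ∑' n : ℕ,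
        if n.Prime then -Real.log (1 - (n : ℝ) ^ (-s)) - (n : ℝ) ^ (-s) else 0)
      (nhdsWithin 1 (Set.Ioi 1))
      (nhds (∑' n : ℕ, if n.Prime then -Real.log (1 - 1 / (n : ℝ)) - 1 / (n : ℝ) else 0)) := by
  refine tendsto_tsum_of_dominated_convergence summable_two_mul_one_div_sq ?_ ?_
  · intro n
    refine tendsto_nhdsWithin_of_tendsto_nhds ?_
    split_ifs with hp
    · have h2 : (2 : ℝ) ≤ n := by exact_mod_cast hp.two_le
      have h1 : (n : ℝ) ^ (-(1 : ℝ)) = 1 / n := by rw [Real.rpow_neg_one, one_div]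
      have hc : ContinuousAt (fun s : ℝ => (n : ℝ) ^ (-s)) 1 :=
        ContinuousAt.rpow continuousAt_const continuousAt_neg (Or.inl (by positivity))
      have h3 : (1 : ℝ) - (n : ℝ) ^ (-(1 : ℝ)) ≠ 0 := by
        have := (rpow_neg_le_half hp le_rfl).2
        rw [h1]; linarith
      have hc2 : ContinuousAt
          (fun s : ℝ => -Real.log (1 - (n : ℝ) ^ (-s)) - (n : ℝ) ^ (-s)) 1 :=
        (((continuousAt_const.sub hc).log h3).neg).sub hc
      have := hc2.tendsto
      rwa [h1] at this
    · exact tendsto_const_nhds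
  · filter_upwards [self_mem_nhdsWithin] with s hs n
    exact abs_ite_prime_neg_log_sub_le n (Set.mem_Ioi.mp hs).le

lemma summable_ite_prime_rpow_neg {s : ℝ} (hs : 1 < s) :
    Summable fun n : ℕ => (if n.Prime then (n : ℝ) ^ (-s) else 0) := by
  refine Summable.of_nonneg_of_le (fun n => ?_) (fun n => ?_) (Real.summable_nat_rpow.mpr
    (by linarith : -s < -1))
  · split_ifs <;> positivity
  · split_ifs
    · exact le_rfl
    · positivity

lemma tsum_ite_prime_neg_log_eq {s : ℝ} (hs : 1 < s) :
    ∑' n : ℕ, (if n.Prime then -Real.log (1 - (n : ℝ) ^ (-s)) else 0)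
      = Real.log (riemannZeta s).re := by
  have h := riemannZeta_eulerProduct_exp_log (s := s) (by simpa using hs)
  have h1 : ∀ p : Nat.Primes, -Complex.log (1 - (p : ℂ) ^ (-(s : ℂ)))
      = ((-Real.log (1 - (p : ℝ) ^ (-s)) : ℝ) : ℂ) := by
    intro p
    obtain ⟨h1, h2⟩ := rpow_neg_le_half p.2 hs.le
    rw [Complex.ofReal_neg, Complex.ofReal_log (by linarith)]
    push_cast
    rw [Complex.ofReal_cpow (by positivity)]
    push_cast
    rfl
  simp_rw [h1] at h
  rw [← Complex.ofReal_tsum, ← Complex.ofReal_exp] at h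
  rw [← h, Complex.ofReal_re, Real.log_exp]
  have := tsum_subtype {p : ℕ | p.Prime} (fun n : ℕ => -Real.log (1 - (n : ℝ) ^ (-s)))
  refine Eq.trans ?_ this.symm
  refine tsum_congr fun n => ?_
  simp [Set.indicator_apply]

lemma tsum_ite_prime_rpow_neg_eq {s : ℝ} (hs : 1 < s) :
    ∑' n : ℕ, (if n.Prime then (n : ℝ) ^ (-s) else 0) = Real.log (riemannZeta s).re
      - ∑' n : ℕ, if n.Prime then -Real.log (1 - (n : ℝ) ^ (-s)) - (n : ℝ) ^ (-s) else 0 := by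
  have h1 : Summable fun n : ℕ =>
      if n.Prime then -Real.log (1 - (n : ℝ) ^ (-s)) - (n : ℝ) ^ (-s) else 0 :=
    Summable.of_norm_bounded summable_two_mul_one_div_sq
      fun n => abs_ite_prime_neg_log_sub_le n hs.le
  rw [← tsum_ite_prime_neg_log_eq hs, eq_sub_iff_add_eq,
    ← (summable_ite_prime_rpow_neg hs).tsum_add h1]
  refine tsum_congr fun n => ?_
  split_ifs <;> ring

lemma tendsto_log_one_sub_exp_neg_sub_log :
    Tendsto (fun ε : ℝ => Real.log (1 - Real.exp (-ε)) - Real.log ε)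
      (nhdsWithin 0 (Set.Ioi 0)) (nhds 0) := by
  have h1 : HasDerivAt (fun ε : ℝ => 1 - Real.exp (-ε)) 1 0 := by
    have := ((hasDerivAt_neg (0 : ℝ)).exp).const_sub 1
    simpa using this
  have h2 := h1.tendsto_slope_zero_right
  have h3 := ((Real.continuousAt_log one_ne_zero).tendsto.comp h2)
  rw [Real.log_one] at h3
  refine h3.congr' ?_
  filter_upwards [self_mem_nhdsWithin] with ε hε
  have hε : 0 < ε := hε
  have : Real.exp (-ε) < 1 := by rw [Real.exp_lt_one_iff]; linarith
  simp only [Function.comp, zero_add, neg_zero, Real.exp_zero, sub_self, sub_zero, smul_eq_mul]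
  rw [Real.log_mul (by positivity) (by linarith), Real.log_inv]
  ring

lemma tendsto_tsum_prime_rpow_add_log :
    Tendsto (fun ε : ℝ => ∑' n : ℕ, (if n.Prime then (n : ℝ) ^ (-(1 + ε)) else 0)
        + Real.log (1 - Real.exp (-ε))) (nhdsWithin 0 (Set.Ioi 0))
      (nhds (-∑' n : ℕ, if n.Prime then -Real.log (1 - 1 / (n : ℝ)) - 1 / (n : ℝ) else 0)) := by
  have hshift : Tendsto (fun ε : ℝ => 1 + ε) (nhdsWithin 0 (Set.Ioi 0))
      (nhdsWithin 1 (Set.Ioi 1)) := by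
    refine tendsto_nhdsWithin_iff.mpr ⟨tendsto_nhdsWithin_of_tendsto_nhds ?_, ?_⟩
    · exact (continuous_const.add continuous_id).tendsto' 0 1 (by simp)
    · filter_upwards [self_mem_nhdsWithin] with ε hε
      simpa using hε
  have h1 := tendsto_tsum_prime_neg_log_sub.comp hshift
  have h2 := ((Asymptotics.isLittleO_one_iff ℝ).mp
    log_riemannZeta_add_log_sub_isLittleO_ofReal).comp hshift
  have h3 := (h2.add tendsto_log_one_sub_exp_neg_sub_log).sub h1
  rw [zero_add, zero_sub] at h3
  refine h3.congr' ?_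
  filter_upwards [self_mem_nhdsWithin] with ε hε
  have hε : 0 < ε := hε
  rw [tsum_ite_prime_rpow_neg_eq (by linarith : 1 < 1 + ε)]
  simp only [Function.comp, add_sub_cancel_left]
  ring

lemma sum_range_mul_exp_neg_eq_tsum {w v : ℕ → ℝ} (hw0 : w 0 = 0)
    {ε t : ℝ} (hε : 0 < ε) (ht : 0 < t) :
    (∑ n ∈ range (⌊Real.exp (ε⁻¹ * t)⌋₊ + 1), w n - ∑ n ∈ range (⌊ε⁻¹ * t⌋₊ + 1), v n)
        * Real.exp (-t)
      = ∑' n : ℕ, ((if ε * Real.log n ≤ t then w n * Real.exp (-t) else 0)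
        - (if ε * n ≤ t then v n * Real.exp (-t) else 0)) := by
  have hu : 0 < ε⁻¹ * t := by positivity
  have e1 : ∀ n : ℕ, n ≠ 0 → (ε * Real.log n ≤ t ↔ n < ⌊Real.exp (ε⁻¹ * t)⌋₊ + 1) := by
    intro n hn
    have hn' : (0 : ℝ) < n := by positivity
    rw [Nat.lt_add_one_iff, Nat.le_floor_iff (Real.exp_pos _).le, ← Real.log_le_iff_le_exp hn',
      mul_comm, ← le_div_iff₀ hε, div_eq_inv_mul]
  have e2 : ∀ n : ℕ, (ε * (n : ℝ) ≤ t ↔ n < ⌊ε⁻¹ * t⌋₊ + 1) := by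
    intro n
    rw [Nat.lt_add_one_iff, Nat.le_floor_iff hu.le, mul_comm, ← le_div_iff₀ hε, div_eq_inv_mul]
  have h1 := hasSum_sum_of_ne_finset_zero (L := SummationFilter.unconditional ℕ)
    (f := fun n : ℕ => if ε * Real.log n ≤ t then w n * Real.exp (-t) else 0)
    (s := range (⌊Real.exp (ε⁻¹ * t)⌋₊ + 1)) (fun n hn => by
      rcases eq_or_ne n 0 with rfl | h
      · simp [hw0]
      · rw [mem_range, ← e1 n h] at hn
        exact if_neg hn)
  have h2 := hasSum_sum_of_ne_finset_zero (L := SummationFilter.unconditional ℕ)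
    (f := fun n : ℕ => if ε * n ≤ t then v n * Real.exp (-t) else 0)
    (s := range (⌊ε⁻¹ * t⌋₊ + 1)) (fun n hn => by
      rw [mem_range, ← e2 n] at hn
      exact if_neg hn)
  rw [(h1.sub h2).tsum_eq, sub_mul, sum_mul, sum_mul]
  congr 1
  · refine sum_congr rfl fun n hn => ?_
    rcases eq_or_ne n 0 with rfl | h
    · simp [hw0]
    · rw [mem_range, ← e1 n h] at hn
      exact (if_pos hn).symm
  · refine sum_congr rfl fun n hn => ?_
    rw [mem_range, ← e2 n] at hn
    exact (if_pos hn).symm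

lemma hasSum_one_div_mul_exp_neg {ε : ℝ} (hε : 0 < ε) :
    HasSum (fun n : ℕ => 1 / (n : ℝ) * Real.exp (-(ε * n))) (-Real.log (1 - Real.exp (-ε))) := by
  have h1 : |Real.exp (-ε)| < 1 := by
    rw [abs_of_pos (Real.exp_pos _), Real.exp_lt_one_iff]
    linarith
  have h2 := Real.hasSum_pow_div_log_of_abs_lt_one h1
  rw [← hasSum_nat_add_iff' 1]
  simp only [range_one, sum_singleton, Nat.cast_zero, div_zero, zero_mul, sub_zero]
  have h3 : (fun n : ℕ => 1 / ((n + 1 : ℕ) : ℝ) * Real.exp (-(ε * (n + 1 : ℕ))))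
      = fun n : ℕ => Real.exp (-ε) ^ (n + 1) / ((n : ℝ) + 1) := by
    funext n
    rw [← Real.exp_nat_mul]
    push_cast
    rw [show -(ε * ((n : ℝ) + 1)) = ((n : ℝ) + 1) * -ε by ring]
    ring
  rw [h3]
  exact h2

lemma integral_prime_sub_harmonic {ε : ℝ} (hε : 0 < ε) :
    ∫ t in Set.Ioi (0 : ℝ),
        (∑ n ∈ range (⌊Real.exp (ε⁻¹ * t)⌋₊ + 1), (if n.Prime then 1 / n else 0 : ℝ)
          - ∑ n ∈ range (⌊ε⁻¹ * t⌋₊ + 1), 1 / (n : ℝ)) * Real.exp (-t)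
      = ∑' n : ℕ, (if n.Prime then (n : ℝ) ^ (-(1 + ε)) else 0)
        + Real.log (1 - Real.exp (-ε)) := by
  have e1 : (fun n : ℕ => (if n.Prime then 1 / n else 0 : ℝ) * Real.exp (-(ε * Real.log n)))
      = fun n : ℕ => (if n.Prime then (n : ℝ) ^ (-(1 + ε)) else 0) := by
    funext n
    split_ifs with hp
    · have hn : (0 : ℝ) < n := by exact_mod_cast hp.pos
      rw [Real.rpow_def_of_pos hn, one_div, ← Real.exp_log (inv_pos.mpr hn), ← Real.exp_add,
        Real.log_inv]
      congr 1
      ring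
    · exact zero_mul _
  have hs1 := summable_ite_prime_rpow_neg (by linarith : 1 < 1 + ε)
  have hs2 := hasSum_one_div_mul_exp_neg hε
  rw [← e1] at hs1
  have key := hasSum_mul_exp_neg_sub (w := fun n : ℕ => (if n.Prime then 1 / n else 0 : ℝ))
    (v := fun n : ℕ => 1 / (n : ℝ)) (a := fun n : ℕ => ε * Real.log n) (b := fun n : ℕ => ε * n)
    (fun n => mul_nonneg hε.le (Real.log_natCast_nonneg n)) (fun n => by positivity)
    (fun n => by positivity) (fun n => by positivity) hs1 hs2.summable
  have h := (hs1.hasSum.sub hs2).unique key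
  rw [e1, sub_neg_eq_add] at h
  rw [h]
  refine setIntegral_congr_fun measurableSet_Ioi fun t ht => ?_
  exact sum_range_mul_exp_neg_eq_tsum (by simp) hε ht

lemma sum_range_one_div_eq_harmonic (N : ℕ) :
    ∑ n ∈ range (N + 1), 1 / (n : ℝ) = (harmonic N : ℝ) := by
  rw [harmonic, sum_range_succ']
  push_cast
  simp

lemma tendsto_harmonic_floor_sub_log :
    Tendsto (fun u : ℝ => (harmonic ⌊u⌋₊ : ℝ) - Real.log u) atTop
      (nhds Real.eulerMascheroniConstant) := by
  have h1 := Real.tendsto_harmonic_sub_log.comp (tendsto_nat_floor_atTop (α := ℝ))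
  have h2 := (Real.continuousAt_log one_ne_zero).tendsto.comp (tendsto_nat_floor_div_atTop (R := ℝ))
  rw [Real.log_one] at h2
  have h3 := h1.add h2
  rw [add_zero] at h3
  refine h3.congr' ?_
  filter_upwards [eventually_ge_atTop 1] with u hu
  have : (0 : ℝ) < ⌊u⌋₊ := by exact_mod_cast Nat.floor_pos.mpr hu
  simp only [Function.comp]
  rw [Real.log_div this.ne' (by linarith)]
  ring

/-- The constant in Mertens' second theorem. -/
lemma eq_of_abs_sum_prime_inv_sub_le {M C : ℝ} (h : ∀ X : ℝ, 2 ≤ X →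
      |∑ n ∈ range (⌊X⌋₊ + 1), (if n.Prime then 1 / n else 0 : ℝ) - Real.log (Real.log X) - M|
        ≤ C / Real.log X) :
    M = Real.eulerMascheroniConstant
      - ∑' n : ℕ, if n.Prime then -Real.log (1 - 1 / (n : ℝ)) - 1 / (n : ℝ) else 0 := by
  have hexp : ∀ u : ℝ, 1 ≤ u → 2 ≤ Real.exp u := fun u hu => by
    linarith [Real.add_one_le_exp u]
  set S : ℝ → ℝ := fun u => ∑ n ∈ range (⌊Real.exp u⌋₊ + 1), (if n.Prime then 1 / n else 0 : ℝ)
  set D : ℝ → ℝ := fun u => S u - ∑ n ∈ range (⌊u⌋₊ + 1), 1 / (n : ℝ) with hD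
  have hS : ∀ u : ℝ, 1 ≤ u → |S u - Real.log u - M| ≤ C / u := fun u hu => by
    have := h _ (hexp u hu)
    rwa [Real.log_exp] at this
  have hC : 0 ≤ C := by simpa using (abs_nonneg _).trans (hS 1 le_rfl)
  have hlim : Tendsto D atTop (nhds (M - Real.eulerMascheroniConstant)) := by
    have h1 : Tendsto (fun u => S u - Real.log u) atTop (nhds M) := by
      rw [tendsto_iff_norm_sub_tendsto_zero]
      refine tendsto_of_tendsto_of_tendsto_of_le_of_le' tendsto_const_nhds
        (tendsto_const_nhds.div_atTop tendsto_id : Tendsto (fun u : ℝ => C / u) atTop (nhds 0))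
        (Eventually.of_forall fun _ => norm_nonneg _) ?_
      filter_upwards [eventually_ge_atTop 1] with u hu using hS u hu
    refine (h1.sub tendsto_harmonic_floor_sub_log).congr fun u => ?_
    simp only [hD, sum_range_one_div_eq_harmonic]
    ring
  have hbound : ∀ u, 0 < u → |D u| ≤ |M| + C + 1 := by
    intro u hu
    rcases lt_or_ge u 1 with h1 | h1
    · have hfl : ⌊u⌋₊ = 0 := Nat.floor_eq_zero.mpr h1
      have h2 : S u ≤ S 1 := by
        refine sum_le_sum_of_subset_of_nonneg ?_ fun n _ _ => by positivity
        refine range_subset_range.mpr (Nat.add_le_add_right (Nat.floor_le_floor ?_) 1)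
        exact Real.exp_le_exp.mpr h1.le
      have h3 : 0 ≤ S u := sum_nonneg fun n _ => by positivity
      have h4 := hS 1 le_rfl
      simp only [hD, hfl]
      norm_num at h4 ⊢
      rw [abs_of_nonneg h3]
      linarith [le_abs_self (S 1 - M), le_abs_self M]
    · have h2 := hS u h1
      have h3 : C / u ≤ C := div_le_self hC h1
      have h4 := log_le_harmonic_floor u hu.le
      have h5 := harmonic_floor_le_one_add_log u h1
      simp only [hD, sum_range_one_div_eq_harmonic]
      have h6 := neg_abs_le M
      have h7 := le_abs_self M
      rw [abs_le] at h2 ⊢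
      constructor <;> linarith [h2.1, h2.2]
  have hm : Measurable D := by
    have h1 : Measurable fun N : ℕ => ∑ n ∈ range (N + 1), (if n.Prime then 1 / n else 0 : ℝ) :=
      measurable_from_nat
    have h2 : Measurable fun N : ℕ => ∑ n ∈ range (N + 1), 1 / (n : ℝ) := measurable_from_nat
    exact (h1.comp (Nat.measurable_floor.comp Real.measurable_exp)).sub
      (h2.comp Nat.measurable_floor)
  have h1 := tendsto_integral_comp_inv_mul_mul_exp_neg hm hbound hlim
  have h2 := h1.congr' (f₂ := fun ε : ℝ =>
      ∑' n : ℕ, (if n.Prime then (n : ℝ) ^ (-(1 + ε)) else 0) + Real.log (1 - Real.exp (-ε))) (by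
    filter_upwards [self_mem_nhdsWithin] with ε hε
    exact integral_prime_sub_harmonic hε)
  have := tendsto_nhds_unique h2 tendsto_tsum_prime_rpow_add_log
  linarith

lemma summable_two_mul_log_mul_one_div_sq :
    Summable fun n : ℕ => 2 * (1 / (n : ℝ) ^ 2) * Real.log n := by
  have h : Summable fun n : ℕ => 4 * (n : ℝ) ^ (-(3 / 2) : ℝ) :=
    (Real.summable_nat_rpow.mpr (by norm_num)).mul_left 4
  refine h.of_nonneg_of_le (fun n => mul_nonneg (by positivity) (Real.log_natCast_nonneg n))
    fun n => ?_
  rcases Nat.eq_zero_or_pos n with rfl | hn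
  · simp
  have hn' : (0 : ℝ) < n := by exact_mod_cast hn
  have h1 := Real.log_le_rpow_div hn'.le (by norm_num : (0 : ℝ) < 1 / 2)
  have h2 : (n : ℝ) ^ (-(3 / 2) : ℝ) = 1 / (n : ℝ) ^ 2 * (n : ℝ) ^ (1 / 2 : ℝ) := by
    rw [one_div, ← Real.rpow_natCast, ← Real.rpow_neg hn'.le, ← Real.rpow_add hn']
    norm_num
  rw [h2]
  have : (0 : ℝ) ≤ 1 / (n : ℝ) ^ 2 := by positivity
  nlinarith

lemma exists_abs_sum_range_sub_tsum_le {e : ℕ → ℝ} (he : ∀ n, |e n| ≤ 2 * (1 / (n : ℝ) ^ 2)) :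
    ∃ C : ℝ, ∀ X : ℝ, 2 ≤ X →
      |∑ n ∈ range (⌊X⌋₊ + 1), e n - ∑' n, e n| ≤ C / Real.log X := by
  have hs : Summable e := Summable.of_norm_bounded summable_two_mul_one_div_sq he
  have hs' : Summable fun n => |e n * Real.log n| := by
    refine summable_two_mul_log_mul_one_div_sq.of_nonneg_of_le (fun n => abs_nonneg _) fun n => ?_
    rw [abs_mul, abs_of_nonneg (Real.log_natCast_nonneg n)]
    exact mul_le_mul_of_nonneg_right (he n) (Real.log_natCast_nonneg n)
  have htail : ∀ N : ℕ, 2 ≤ N → |∑ n ∈ range N, e n - ∑' n, e n|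
      ≤ (∑' n, |e n * Real.log n|) * (Real.log N)⁻¹ := by
    intro N hN
    have hlog : 0 < Real.log N := Real.log_pos (by exact_mod_cast hN)
    rw [← hs.sum_add_tsum_nat_add N, sub_add_cancel_left, abs_neg]
    have h1 : Summable fun n => |e (n + N) * Real.log (n + N : ℕ)| :=
      (summable_nat_add_iff (f := fun n => |e n * Real.log n|) N).mpr hs'
    have h2 : Summable fun n => |e (n + N)| :=
      (summable_nat_add_iff (f := fun n => |e n|) N).mpr hs.abs
    have h4 : |∑' n, e (n + N)| ≤ ∑' n, |e (n + N)| := by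
      have := norm_tsum_le_tsum_norm (f := fun n => e (n + N))
        (by simpa only [Real.norm_eq_abs] using h2)
      simpa only [Real.norm_eq_abs] using this
    refine h4.trans ?_
    have h3 : ∑' n, |e (n + N) * Real.log (n + N : ℕ)| ≤ ∑' n, |e n * Real.log n| := by
      rw [← hs'.sum_add_tsum_nat_add N]
      exact le_add_of_nonneg_left (sum_nonneg fun _ _ => abs_nonneg _)
    refine le_trans ?_ (mul_le_mul_of_nonneg_right h3 (inv_nonneg.mpr hlog.le))
    rw [← tsum_mul_right]
    refine h2.tsum_le_tsum (fun n => ?_) (h1.mul_right _)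
    rw [← div_eq_mul_inv, le_div_iff₀ hlog, abs_mul,
      abs_of_nonneg (Real.log_natCast_nonneg (n + N))]
    refine mul_le_mul_of_nonneg_left ?_ (abs_nonneg _)
    exact Real.log_le_log (by positivity) (by exact_mod_cast Nat.le_add_left N n)
  refine ⟨∑' n, |e n * Real.log n|, fun X hX => ?_⟩
  have hN : 2 ≤ ⌊X⌋₊ + 1 := by have := Nat.le_floor (n := 2) (by exact_mod_cast hX); omega
  refine (htail _ hN).trans ?_
  rw [div_eq_mul_inv]
  exact mul_le_mul_of_nonneg_left (inv_log_floor_succ_le hX) (tsum_nonneg fun _ => abs_nonneg _)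

/-- Mertens' third theorem. -/
lemma exists_abs_sum_prime_log_one_sub_inv_add_le :
    ∃ C : ℝ, ∀ X : ℝ, 2 ≤ X →
      |∑ n ∈ range (⌊X⌋₊ + 1), (if n.Prime then Real.log (1 - 1 / (n : ℝ)) else 0)
        + Real.log (Real.log X) + Real.eulerMascheroniConstant| ≤ C / Real.log X := by
  obtain ⟨M, C, h⟩ := exists_abs_sum_prime_inv_sub_le
  have hM := eq_of_abs_sum_prime_inv_sub_le h
  set e : ℕ → ℝ := fun n => if n.Prime then -Real.log (1 - 1 / (n : ℝ)) - 1 / (n : ℝ) else 0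
    with he
  have hes : ∀ n, |e n| ≤ 2 * (1 / (n : ℝ) ^ 2) := fun n => by
    simpa [he, Real.rpow_neg_one] using abs_ite_prime_neg_log_sub_le n (le_refl (1 : ℝ))
  have hsum : Summable e := Summable.of_norm_bounded summable_two_mul_one_div_sq hes
  obtain ⟨C', hC'⟩ := exists_abs_sum_range_sub_tsum_le hes
  refine ⟨C + C', fun X hX => ?_⟩
  have hl : 0 < Real.log X := Real.log_pos (by linarith)
  have htail : |∑ n ∈ range (⌊X⌋₊ + 1), e n - ∑' n, e n| ≤ C' / Real.log X :=
    hC' X hX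
  have h1 := h X hX
  have h2 : ∑ n ∈ range (⌊X⌋₊ + 1), (if n.Prime then Real.log (1 - 1 / (n : ℝ)) else 0)
      = - ∑ n ∈ range (⌊X⌋₊ + 1), (if n.Prime then 1 / n else 0 : ℝ)
        - ∑ n ∈ range (⌊X⌋₊ + 1), e n := by
    rw [← sum_neg_distrib, ← sum_sub_distrib]
    refine sum_congr rfl fun n _ => ?_
    simp only [he]
    split_ifs <;> ring
  rw [h2, add_div]
  rw [abs_le] at *
  constructor <;> linarith [h1.1, h1.2, htail.1, htail.2]

section DirichletCharacter

variable {q : ℕ} [NeZero q] {χ : DirichletCharacter ℂ q}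

lemma sum_range_zmod_natCast {A : Type*} [AddCommMonoid A] (f : ZMod q → A) :
    ∑ n ∈ range q, f n = ∑ a, f a := by
  refine sum_nbij' (fun n => (n : ZMod q)) ZMod.val (by simp) ?_ ?_ (by simp) (by simp)
  · exact fun a _ => mem_range.mpr a.val_lt
  · exact fun n hn => ZMod.val_cast_of_lt (mem_range.mp hn)

lemma norm_sum_range_dirichletCharacter_le (hχ : χ ≠ 1) (N : ℕ) :
    ‖∑ n ∈ range N, χ n‖ ≤ q := by
  induction N using Nat.strong_induction_on with
  | _ N ih =>
    rcases lt_or_ge N q with h | h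
    · refine (norm_sum_le_of_le (f := fun n : ℕ => χ n) _ fun n _ => χ.norm_le_one n).trans ?_
      simpa using h.le
    · obtain ⟨M, rfl⟩ := Nat.exists_eq_add_of_le h
      rw [sum_range_add, sum_range_zmod_natCast (fun a => χ a), MulChar.sum_eq_zero_of_ne_one hχ,
        zero_add]
      simpa using ih M (by have := NeZero.pos q; omega)

lemma tendsto_of_norm_sub_le_mul {u : ℕ → ℂ} {L : ℂ} {f : ℕ → ℝ} {K : ℝ} {M : ℕ}
    (h : ∀ N ≥ M, ‖u N - L‖ ≤ K * f N) (hf : Tendsto f atTop (nhds 0)) :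
    Tendsto u atTop (nhds L) := by
  rw [tendsto_iff_norm_sub_tendsto_zero]
  have hf' := hf.const_mul K
  rw [mul_zero] at hf'
  refine tendsto_of_tendsto_of_tendsto_of_le_of_le' tendsto_const_nhds hf'
    (Eventually.of_forall fun _ => norm_nonneg _) ?_
  filter_upwards [eventually_ge_atTop M] with N hN using h N hN

lemma hasSum_rpow_smul_dirichletCharacter (χ : DirichletCharacter ℂ q) {s : ℝ} (hs : 1 < s) :
    HasSum (fun n : ℕ => ((n : ℝ) ^ (-s)) • χ n) (DirichletCharacter.LFunction χ s) := by
  have h3 : 1 < (s : ℂ).re := by simpa using hs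
  rw [DirichletCharacter.LFunction_eq_LSeries χ h3]
  have h4 : HasSum _ _ := (DirichletCharacter.LSeriesSummable_of_one_lt_re χ h3).hasSum
  have h5 : (fun n : ℕ => ((n : ℝ) ^ (-s)) • χ n) = LSeries.term (χ ·) s := by
    funext n
    rw [LSeries.term_def]
    split_ifs with hn
    · simp [hn, Real.zero_rpow (by linarith : -s ≠ 0)]
    · rw [Complex.real_smul, Complex.ofReal_cpow n.cast_nonneg, Complex.ofReal_neg,
        Complex.cpow_neg, Complex.ofReal_natCast, div_eq_inv_mul]
  rw [h5]
  exact h4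

lemma norm_sum_range_rpow_smul_sub_LFunction_le (hχ : χ ≠ 1) {s : ℝ} (hs : 1 < s) {N : ℕ}
    (hN : 1 ≤ N) :
    ‖∑ n ∈ range N, ((n : ℝ) ^ (-s)) • χ n - DirichletCharacter.LFunction χ s‖
      ≤ 2 * q * (N : ℝ) ^ (-s) := by
  have hf : Tendsto (fun n : ℕ => (n : ℝ) ^ (-s)) atTop (nhds 0) :=
    (tendsto_rpow_neg_atTop (by linarith)).comp tendsto_natCast_atTop_atTop
  obtain ⟨L, hL⟩ := exists_norm_sum_range_smul_sub_le (f := fun n : ℕ => (n : ℝ) ^ (-s)) (M := 1)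
    (norm_sum_range_dirichletCharacter_le hχ)
    (fun i hi => Real.rpow_le_rpow_of_nonpos (by exact_mod_cast hi) (by simp) (by linarith))
    (fun i _ => by positivity) hf
  rw [tendsto_nhds_unique (hasSum_rpow_smul_dirichletCharacter χ hs).tendsto_sum_nat
    (tendsto_of_norm_sub_le_mul hL hf)]
  exact hL N hN

lemma norm_sum_range_div_sub_LFunction_le (hχ : χ ≠ 1) {N : ℕ} (hN : 1 ≤ N) :
    ‖∑ n ∈ range N, χ n / n - DirichletCharacter.LFunction χ 1‖ ≤ 2 * q / N := by
  have h1 : Tendsto (fun s : ℝ => ‖∑ n ∈ range N, ((n : ℝ) ^ (-s)) • χ n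
      - DirichletCharacter.LFunction χ s‖) (nhdsWithin 1 (Set.Ioi 1))
      (nhds ‖∑ n ∈ range N, ((n : ℝ) ^ (-(1 : ℝ))) • χ n
        - DirichletCharacter.LFunction χ (1 : ℝ)‖) := by
    refine (Tendsto.sub ?_ ?_).norm
    · refine tendsto_finsetSum _ fun n _ => ?_
      refine (Tendsto.mono_left ?_ nhdsWithin_le_nhds).smul_const _
      rcases Nat.eq_zero_or_pos n with rfl | hn
      · simp only [Nat.cast_zero]
        rw [Real.zero_rpow (by norm_num)]
        refine tendsto_const_nhds.congr' ?_
        filter_upwards [eventually_gt_nhds (zero_lt_one' ℝ)] with s hs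
        rw [Real.zero_rpow (by linarith)]
      · have hn' : (n : ℝ) ≠ 0 := by positivity
        exact (Real.continuousAt_const_rpow hn').tendsto.comp (continuous_neg.tendsto 1)
    · exact (((DirichletCharacter.differentiable_LFunction hχ).continuous.comp
        Complex.continuous_ofReal).tendsto 1).mono_left nhdsWithin_le_nhds
  have h2 : ∀ᶠ s : ℝ in nhdsWithin 1 (Set.Ioi 1), ‖∑ n ∈ range N, ((n : ℝ) ^ (-s)) • χ n
      - DirichletCharacter.LFunction χ s‖ ≤ 2 * q / N := by
    filter_upwards [self_mem_nhdsWithin] with s hs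
    refine (norm_sum_range_rpow_smul_sub_LFunction_le hχ hs hN).trans ?_
    rw [div_eq_mul_inv, ← Real.rpow_neg_one]
    gcongr
    · exact_mod_cast hN
    · exact le_of_lt hs
  have h3 := le_of_tendsto h1 h2
  rw [Complex.ofReal_one] at h3
  have h4 : ∀ n : ℕ, χ n / n = ((n : ℝ) ^ (-(1 : ℝ))) • χ n := fun n => by
    rw [Real.rpow_neg_one, Complex.real_smul, div_eq_inv_mul]
    simp
  simpa only [h4] using h3

lemma exists_norm_sum_dirichletCharacter_mul_log_div_le (hχ : χ ≠ 1) :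
    ∃ C : ℝ, ∀ N : ℕ, ‖∑ n ∈ range N, χ n * Real.log n / n‖ ≤ C := by
  have hf : Tendsto (fun n : ℕ => Real.log n / n) atTop (nhds 0) :=
    (Real.isLittleO_log_id_atTop.tendsto_div_nhds_zero).comp tendsto_natCast_atTop_atTop
  obtain ⟨L, hL⟩ := exists_norm_sum_range_smul_sub_le (f := fun n : ℕ => Real.log n / n) (M := 3)
    (norm_sum_range_dirichletCharacter_le hχ) (fun i hi => by
      have h3 : Real.exp 1 ≤ i := by
        have : (3 : ℝ) ≤ i := by exact_mod_cast hi
        linarith [Real.exp_one_lt_d9]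
      refine Real.log_div_self_antitoneOn h3 ?_ (by simp)
      exact h3.trans (by simp))
    (fun i _ => div_nonneg (Real.log_natCast_nonneg i) i.cast_nonneg) hf
  obtain ⟨C, hC⟩ := isBounded_iff_forall_norm_le.mp
    (Metric.isBounded_range_of_tendsto _ (tendsto_of_norm_sub_le_mul hL hf))
  refine ⟨C, fun N => ?_⟩
  have h4 : ∀ n : ℕ, χ n * Real.log n / n = (Real.log n / n) • χ n := fun n => by
    rw [Complex.real_smul]
    push_cast
    ring
  simp only [h4]
  exact hC _ ⟨N, rfl⟩

lemma sum_dirichletCharacter_mul_log_div_eq {q : ℕ} (χ : DirichletCharacter ℂ q) (N : ℕ) :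
    ∑ n ∈ Ioc 0 N, χ n * Real.log n / n
      = ∑ d ∈ Ioc 0 N, χ d * Λ d / d * ∑ m ∈ Ioc 0 (N / d), χ m / m := by
  let f : ArithmeticFunction ℂ := ⟨fun n => χ n * Λ n / n, by simp⟩
  let g : ArithmeticFunction ℂ := ⟨fun n => χ n / n, by simp⟩
  have h := ArithmeticFunction.sum_Ioc_mul_eq_sum_sum f g N
  refine Eq.trans (sum_congr rfl fun n hn => ?_) h
  have hn0 : n ≠ 0 := by have := (mem_Ioc.mp hn).1; omega
  rw [ArithmeticFunction.mul_apply, ← ArithmeticFunction.vonMangoldt_sum,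
    ← Nat.sum_divisorsAntidiagonal (fun d _ => Λ d), Complex.ofReal_sum, mul_sum, sum_div]
  refine sum_congr rfl fun x hx => ?_
  obtain ⟨hx, _⟩ := Nat.mem_divisorsAntidiagonal.mp hx
  change _ = χ x.1 * Λ x.1 / x.1 * (χ x.2 / x.2)
  rw [← hx, Nat.cast_mul, map_mul, Nat.cast_mul, div_mul_div_comm]
  ring

/-- Mertens' theorem for a nontrivial character: `∑ χ(n) Λ(n) / n` has bounded partial sums. -/
lemma exists_norm_sum_dirichletCharacter_mul_vonMangoldt_div_le (hχ : χ ≠ 1) :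
    ∃ C : ℝ, ∀ N : ℕ, ‖∑ n ∈ Ioc 0 N, χ n * Λ n / n‖ ≤ C := by
  obtain ⟨C, hC⟩ := exists_norm_sum_dirichletCharacter_mul_log_div_le hχ
  set l := DirichletCharacter.LFunction χ 1 with hl
  have hl0 : 0 < ‖l‖ := norm_pos_iff.mpr (DirichletCharacter.LFunction_apply_one_ne_zero hχ)
  refine ⟨(C + 2 * q * (Real.log 4 + 4)) / ‖l‖, fun N => ?_⟩
  rw [le_div_iff₀ hl0, ← norm_mul]
  rcases Nat.eq_zero_or_pos N with rfl | hN
  · have : 0 ≤ C := (norm_nonneg _).trans (hC 0)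
    have := Real.log_nonneg (by norm_num : (1 : ℝ) ≤ 4)
    simp only [Ioc_self, sum_empty, zero_mul, norm_zero]
    positivity
  have hN' : (0 : ℝ) < N := by exact_mod_cast hN
  have h1 := hC (N + 1)
  rw [sum_range_succ_eq_sum_Ioc (by simp), sum_dirichletCharacter_mul_log_div_eq] at h1
  have h2 : ‖∑ d ∈ Ioc 0 N, χ d * Λ d / d * (∑ m ∈ Ioc 0 (N / d), χ m / m - l)‖
      ≤ ∑ d ∈ Ioc 0 N, 2 * q / N * Λ d := by
    refine norm_sum_le_of_le _ fun d hd => ?_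
    have hd0 : 0 < d := (mem_Ioc.mp hd).1
    have hd' : (0 : ℝ) < d := by exact_mod_cast hd0
    have h3 := norm_sum_range_div_sub_LFunction_le hχ (Nat.le_add_left 1 (N / d))
    rw [sum_range_succ_eq_sum_Ioc (by simp)] at h3
    have h4 : (2 * q / (N / d + 1 : ℕ) : ℝ) ≤ 2 * q / (N / d) := by
      refine div_le_div_of_nonneg_left (by positivity) (by positivity) ?_
      rw [div_le_iff₀ hd']
      exact_mod_cast (Nat.lt_mul_of_div_lt (Nat.lt_succ_self (N / d)) hd0).le
    have h5 : ‖χ d * Λ d / d‖ ≤ Λ d / d := by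
      rw [norm_div, norm_mul, Complex.norm_real, Real.norm_of_nonneg
        ArithmeticFunction.vonMangoldt_nonneg, Complex.norm_natCast]
      refine div_le_div_of_nonneg_right ?_ hd'.le
      exact mul_le_of_le_one_left ArithmeticFunction.vonMangoldt_nonneg (χ.norm_le_one _)
    rw [norm_mul]
    refine (mul_le_mul h5 (h3.trans h4) (norm_nonneg _)
      (div_nonneg ArithmeticFunction.vonMangoldt_nonneg hd'.le)).trans_eq ?_
    field_simp
  have h3 : ∑ d ∈ Ioc 0 N, 2 * q / N * Λ d ≤ 2 * q * (Real.log 4 + 4) := by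
    have h4 := Chebyshev.psi_le_const_mul_self hN'.le
    rw [Chebyshev.psi, Nat.floor_natCast] at h4
    rw [← mul_sum, div_mul_eq_mul_div, div_le_iff₀ hN', mul_assoc (2 * q : ℝ)]
    exact mul_le_mul_of_nonneg_left h4 (by positivity)
  have h4 : (∑ n ∈ Ioc 0 N, χ n * Λ n / n) * l
      = ∑ d ∈ Ioc 0 N, χ d * Λ d / d * ∑ m ∈ Ioc 0 (N / d), χ m / m
        - ∑ d ∈ Ioc 0 N, χ d * Λ d / d * (∑ m ∈ Ioc 0 (N / d), χ m / m - l) := by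
    rw [← sum_sub_distrib, sum_mul]
    exact sum_congr rfl fun d _ => by ring
  rw [h4]
  exact (norm_sub_le _ _).trans (add_le_add h1 (h2.trans h3))

end DirichletCharacter

section ResidueClass

open ArithmeticFunction (vonMangoldt)

variable {q : ℕ} [NeZero q] {a : ZMod q}

lemma exists_norm_sum_one_sub_one_mul_vonMangoldt_div_le (q : ℕ) [NeZero q] :
    ∃ C : ℝ, ∀ N : ℕ, ‖∑ n ∈ Ioc 0 N, ((1 : DirichletCharacter ℂ q) n - 1) * Λ n / n‖ ≤ C := by
  have h1 : Summable fun n : ℕ => (if n ∣ q then Λ n / n else 0 : ℝ) :=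
    summable_of_ne_finset_zero (s := range (q + 1)) fun n hn => if_neg fun h =>
      hn (mem_range.mpr (Nat.lt_succ_of_le (Nat.le_of_dvd (NeZero.pos q) h)))
  have h2 := h1.add summable_vonMangoldt_div_of_not_prime
  refine ⟨_, fun N => (norm_sum_le_of_le _ fun n _ => ?_).trans (h2.sum_le_tsum (Ioc 0 N) ?_)⟩
  · have h0 : 0 ≤ Λ n / n := div_nonneg ArithmeticFunction.vonMangoldt_nonneg n.cast_nonneg
    by_cases hu : IsUnit (n : ZMod q)
    · rw [MulChar.one_apply hu, sub_self, zero_mul, zero_div, norm_zero]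
      positivity
    · have h3 : ‖((1 : DirichletCharacter ℂ q) n - 1) * Λ n / n‖ = Λ n / n := by
        rw [MulChar.map_nonunit _ hu, zero_sub, neg_mul, one_mul, neg_div, norm_neg, norm_div,
          Complex.norm_real, Real.norm_of_nonneg ArithmeticFunction.vonMangoldt_nonneg,
          Complex.norm_natCast]
      rw [h3]
      by_cases hp : n.Prime
      · have hd : n ∣ q := by
          rwa [ZMod.isUnit_iff_coprime, hp.coprime_iff_not_dvd, not_not] at hu
        simp [hp, hd]
      · simp only [hp, if_false]
        exact le_add_of_nonneg_left (by positivity)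
  · intro n _
    have h0 : 0 ≤ Λ n / n := div_nonneg ArithmeticFunction.vonMangoldt_nonneg n.cast_nonneg
    positivity

lemma exists_abs_sum_residueClass_sub_vonMangoldt_div_le (ha : IsUnit a) :
    ∃ C : ℝ, ∀ N : ℕ,
      |∑ n ∈ range N, (q.totient * vonMangoldt.residueClass a n - Λ n) / n| ≤ C := by
  have h1 : ∀ χ : DirichletCharacter ℂ q, ∃ C : ℝ, ∀ N : ℕ,
      ‖∑ n ∈ Ioc 0 N, (χ n - if χ = 1 then 1 else 0) * Λ n / n‖ ≤ C := fun χ => by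
    by_cases hχ : χ = 1
    · simpa [hχ] using exists_norm_sum_one_sub_one_mul_vonMangoldt_div_le q
    · simpa [hχ] using exists_norm_sum_dirichletCharacter_mul_vonMangoldt_div_le hχ
  choose C hC using h1
  have h2 : ∀ n : ℕ, (((q.totient * vonMangoldt.residueClass a n - Λ n) / n : ℝ) : ℂ)
      = ∑ χ : DirichletCharacter ℂ q,
        χ a⁻¹ * ((χ n - if χ = 1 then 1 else 0) * Λ n / n) := fun n => by
    have hφ : (q.totient : ℂ) ≠ 0 := by
      exact_mod_cast (Nat.totient_pos.mpr (NeZero.pos q)).ne'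
    have h3 : (1 : DirichletCharacter ℂ q) a⁻¹ = 1 := by
      refine MulChar.one_apply ?_
      obtain ⟨u, rfl⟩ := ha
      rw [ZMod.inv_coe_unit]
      exact Units.isUnit _
    push_cast
    rw [vonMangoldt.residueClass_apply ha, mul_inv_cancel_left₀ hφ]
    have h4 : ∀ χ : DirichletCharacter ℂ q,
        χ a⁻¹ * ((χ n - if χ = 1 then 1 else 0) * Λ n / n)
          = (χ a⁻¹ * χ n * Λ n - if χ = 1 then (χ a⁻¹ * Λ n : ℂ) else 0) / n := fun χ => by
      split_ifs <;> ring
    simp only [h4]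
    rw [← sum_div, sum_sub_distrib, sum_ite_eq' univ, if_pos (mem_univ _), h3, one_mul]
  refine ⟨∑ χ, C χ, fun N => ?_⟩
  have hC0 : 0 ≤ ∑ χ, C χ := sum_nonneg fun χ _ => (norm_nonneg _).trans (hC χ 0)
  rcases N with _ | N
  · simpa using hC0
  rw [sum_range_succ_eq_sum_Ioc (by simp), ← Real.norm_eq_abs, ← Complex.norm_real,
    Complex.ofReal_sum]
  simp only [h2]
  rw [sum_comm]
  refine norm_sum_le_of_le _ fun χ _ => ?_
  rw [← mul_sum, norm_mul]
  exact (mul_le_of_le_one_left (norm_nonneg _) (χ.norm_le_one _)).trans (hC χ N)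

lemma exists_abs_sum_prime_one_sub_mul_log_div_le (ha : IsUnit a) :
    ∃ C : ℝ, ∀ N : ℕ, |∑ n ∈ range N, (if n.Prime then
      (1 - (if (n : ZMod q) = a then 1 else 0) * q.totient) * (Real.log n / n) else 0 : ℝ)|
        ≤ C := by
  obtain ⟨C, hC⟩ := exists_abs_sum_residueClass_sub_vonMangoldt_div_le ha
  set r : ℕ → ℝ := fun n =>
    q.totient * ((if n.Prime then 0 else vonMangoldt.residueClass a n) / n)
      - if n.Prime then 0 else Λ n / n with hr
  have h1 : Summable r :=
    ((vonMangoldt.summable_residueClass_non_primes_div a).mul_left (q.totient : ℝ)).sub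
      summable_vonMangoldt_div_of_not_prime
  refine ⟨C + ∑' n, |r n|, fun N => ?_⟩
  have h2 : ∀ n : ℕ, (if n.Prime then
      (1 - (if (n : ZMod q) = a then 1 else 0) * q.totient) * (Real.log n / n) else 0 : ℝ)
      = - ((q.totient * vonMangoldt.residueClass a n - Λ n) / n) + r n := fun n => by
    simp only [hr]
    by_cases hp : n.Prime
    · have h3 : vonMangoldt.residueClass a n
          = (if (n : ZMod q) = a then 1 else 0) * Real.log n := by
        rw [vonMangoldt.residueClass, Set.indicator_apply,
          ArithmeticFunction.vonMangoldt_apply_prime hp]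
        simp [ite_mul]
      rw [h3, ArithmeticFunction.vonMangoldt_apply_prime hp]
      simp only [hp, if_true]
      ring
    · simp only [hp, if_false]
      ring
  simp only [h2]
  rw [sum_add_distrib, sum_neg_distrib]
  refine (abs_add_le _ _).trans (add_le_add ?_ (abs_sum_le_tsum_abs h1.abs _))
  rw [abs_neg]
  exact hC N

/-- Convergence of the logarithm of the product defining `P_c`, with a rate. -/
lemma exists_abs_sum_prime_one_sub_mul_log_sub_le (ha : IsUnit a) :
    ∃ L C : ℝ, ∀ N : ℕ, 2 ≤ N → |∑ n ∈ range N, (if n.Prime then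
      (1 - (if (n : ZMod q) = a then 1 else 0) * q.totient) * Real.log (1 - 1 / (n : ℝ)) else 0 : ℝ)
        - L| ≤ C * (Real.log N)⁻¹ := by
  obtain ⟨C, hC⟩ := exists_abs_sum_prime_one_sub_mul_log_div_le ha
  set d : ℕ → ℝ := fun n => 1 - (if (n : ZMod q) = a then 1 else 0) * q.totient with hd
  have hd1 : ∀ n, |d n| ≤ 1 + q.totient := fun n => by
    have : (0 : ℝ) ≤ q.totient := by positivity
    simp only [hd]
    split_ifs <;> rw [abs_le] <;> constructor <;> linarith
  set e : ℕ → ℝ := fun n => if n.Prime then -Real.log (1 - 1 / (n : ℝ)) - 1 / (n : ℝ) else 0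
    with he
  have hes : ∀ n, |e n| ≤ 2 * (1 / (n : ℝ) ^ 2) := fun n => by
    simpa [he, Real.rpow_neg_one] using abs_ite_prime_neg_log_sub_le n (le_refl (1 : ℝ))
  have hsum : Summable fun n => d n * (e n * Real.log n) := by
    refine Summable.of_norm_bounded
      (summable_two_mul_log_mul_one_div_sq.mul_left (1 + q.totient : ℝ)) fun n => ?_
    rw [norm_mul, norm_mul, Real.norm_of_nonneg (Real.log_natCast_nonneg n)]
    refine mul_le_mul (hd1 n) ?_ (by positivity [Real.log_natCast_nonneg n]) (by positivity)
    exact mul_le_mul_of_nonneg_right (hes n) (Real.log_natCast_nonneg n)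
  set b : ℕ → ℝ := fun n => if n.Prime then d n * Real.log (1 - 1 / (n : ℝ)) * Real.log n else 0
    with hb
  have h1 : ∀ N, ‖∑ n ∈ range N, b n‖ ≤ C + ∑' n, |d n * (e n * Real.log n)| := fun N => by
    have h2 : ∀ n, b n = -(if n.Prime then d n * (Real.log n / n) else 0)
        - d n * (e n * Real.log n) := fun n => by
      simp only [hb, he]
      split_ifs <;> ring
    simp only [h2]
    rw [sum_sub_distrib, sum_neg_distrib, Real.norm_eq_abs]
    refine (abs_sub _ _).trans (add_le_add ?_ (abs_sum_le_tsum_abs hsum.abs _))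
    rw [abs_neg]
    exact hC N
  obtain ⟨L, hL⟩ := exists_norm_sum_range_smul_sub_le (f := fun n : ℕ => (Real.log n)⁻¹) (M := 2)
    h1 (fun i hi => inv_log_succ_le hi) (fun i _ => inv_nonneg.mpr (Real.log_natCast_nonneg i))
    tendsto_inv_log_natCast
  refine ⟨L, 2 * (C + ∑' n, |d n * (e n * Real.log n)|), fun N hN => ?_⟩
  have h3 := hL N hN
  have h4 : ∀ n : ℕ, (Real.log n)⁻¹ • b n
      = if n.Prime then d n * Real.log (1 - 1 / (n : ℝ)) else 0 := fun n => by
    simp only [hb]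
    split_ifs with hp
    · have : Real.log n ≠ 0 := (Real.log_pos (by exact_mod_cast hp.one_lt)).ne'
      rw [smul_eq_mul]
      field_simp
    · exact smul_zero _
  simp only [h4] at h3
  exact h3

end ResidueClass

lemma sum_primesUpTo_eq (g : ℕ → ℝ) {X : ℝ} (hX : 0 ≤ X) :
    ∑ p ∈ primesUpTo X, g p = ∑ n ∈ range (⌊X⌋₊ + 1), if n.Prime then g n else 0 := by
  rw [primesUpTo, ← sum_filter]
  refine sum_congr (filter_congr fun p hp => ?_) fun _ _ => rfl
  exact and_iff_left ((Nat.le_floor_iff hX).mp (Nat.lt_succ_iff.mp (mem_range.mp hp)))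

lemma prime_of_mem_primesUpTo {X : ℝ} {p : ℕ} (hp : p ∈ primesUpTo X) : p.Prime :=
  (mem_filter.mp hp).2.1

lemma Nat.Prime.one_sub_one_div_pos {p : ℕ} (hp : p.Prime) : 0 < 1 - 1 / (p : ℝ) := by
  have : (1 : ℝ) < p := by exact_mod_cast hp.one_lt
  rw [sub_pos, div_lt_one (by linarith)]
  exact this

lemma abs_exp_sub_one_le_abs_mul_exp (x : ℝ) : |Real.exp x - 1| ≤ |x| * Real.exp |x| := by
  rcases le_total 0 x with h | h
  · rw [abs_of_nonneg h, abs_of_nonneg (by linarith [Real.add_one_le_exp x])]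
    have h1 := mul_le_mul_of_nonneg_right (Real.add_one_le_exp (-x)) (Real.exp_pos x).le
    rw [← Real.exp_add, neg_add_cancel, Real.exp_zero] at h1
    linarith
  · have h1 : Real.exp x ≤ 1 := Real.exp_le_one_iff.mpr h
    rw [abs_of_nonpos h, abs_of_nonpos (by linarith)]
    have h2 : 1 ≤ Real.exp (-x) := Real.one_le_exp (by linarith)
    nlinarith [Real.add_one_le_exp x]

lemma one_le_log_of_three_le {X : ℝ} (hX : 3 ≤ X) : 1 ≤ Real.log X := by
  rw [Real.le_log_iff_exp_le (by linarith)]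
  linarith [Real.exp_one_lt_d9]

lemma prod_primesUpTo_zpow_eq_exp (d : ℕ → ℤ) {X : ℝ} (hX : 0 ≤ X) :
    ∏ p ∈ primesUpTo X, (1 - 1 / (p : ℝ)) ^ d p
      = Real.exp (∑ n ∈ range (⌊X⌋₊ + 1),
          if n.Prime then (d n : ℝ) * Real.log (1 - 1 / (n : ℝ)) else 0) := by
  rw [← sum_primesUpTo_eq (fun n => (d n : ℝ) * Real.log (1 - 1 / (n : ℝ))) hX, Real.exp_sum]
  refine prod_congr rfl fun p hp => ?_
  rw [← Real.rpow_intCast, Real.rpow_def_of_pos (prime_of_mem_primesUpTo hp).one_sub_one_div_pos,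
    mul_comm]

lemma prod_filter_primesUpTo_rpow_eq_exp (P : ℕ → Prop) [DecidablePred P] (κ : ℝ) {X : ℝ}
    (hX : 0 ≤ X) :
    ∏ p ∈ (primesUpTo X).filter P, (1 - 1 / (p : ℝ)) ^ (-κ)
      = Real.exp (-κ * ∑ n ∈ range (⌊X⌋₊ + 1),
          if n.Prime then (if P n then 1 else 0) * Real.log (1 - 1 / (n : ℝ)) else 0) := by
  rw [← sum_primesUpTo_eq (fun n => (if P n then 1 else 0) * Real.log (1 - 1 / (n : ℝ))) hX,
    mul_sum, Real.exp_sum, prod_filter]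
  refine prod_congr rfl fun p hp => ?_
  split_ifs
  · rw [Real.rpow_def_of_pos (prime_of_mem_primesUpTo hp).one_sub_one_div_pos]
    congr 1
    ring
  · simp

/-- Mertens' theorem for arithmetic progressions: for `gcd(c,q)=1` the product
`P_c = ∏_p (1−1/p)^{1−δ_q(p,c)φ(q)}` converges to a positive limit, and for all `X ≥ 3`,
`∏_{p ≤ X, p ≡ c (q)} (1−1/p)^{−κ} = (e^γ P_c log X)^{κ/φ(q)} (1 + O_{q,κ}(1/log X))`. -/
theorem mertens_arithmetic_progressions (q : ℕ) [NeZero q] (c : ℤ) (hgcd : Int.gcd c (q : ℤ) = 1)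
    (κ : ℝ) :
    ∃ Pc : ℝ, 0 < Pc ∧
      Tendsto (fun Y : ℕ => ∏ p ∈ primesUpTo (Y : ℝ),
          (1 - 1 / (p : ℝ)) ^ ((1 : ℤ) -
            (if ((p : ℕ) : ZMod q) = ((c : ℤ) : ZMod q) then 1 else 0) * (q.totient : ℤ)))
        atTop (nhds Pc) ∧
      ∃ C : ℝ, ∀ X : ℝ, 3 ≤ X →
        ∃ E : ℝ, |E| ≤ C / Real.log X ∧
          (∏ p ∈ (primesUpTo X).filter (fun p : ℕ => ((p : ℕ) : ZMod q) = ((c : ℤ) : ZMod q)),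
              (1 - 1 / (p : ℝ)) ^ (-κ))
            = (Real.exp Real.eulerMascheroniConstant * Pc * Real.log X) ^ (κ / (q.totient : ℝ))
                * (1 + E) := by
  have ha : IsUnit ((c : ℤ) : ZMod q) := by
    rw [ZMod.coe_int_isUnit_iff_isCoprime, Int.isCoprime_iff_gcd_eq_one, Int.gcd_comm]
    exact hgcd
  obtain ⟨L, C₁, hL⟩ := exists_abs_sum_prime_one_sub_mul_log_sub_le ha
  obtain ⟨C₂, hM⟩ := exists_abs_sum_prime_log_one_sub_inv_add_le
  have hφ : (0 : ℝ) < q.totient := by exact_mod_cast Nat.totient_pos.mpr (NeZero.pos q)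
  set a : ZMod q := ((c : ℤ) : ZMod q)
  set S : ℕ → ℝ := fun N => ∑ n ∈ range N, (if n.Prime then
    (1 - (if (n : ZMod q) = a then 1 else 0) * q.totient) * Real.log (1 - 1 / (n : ℝ)) else 0 : ℝ)
    with hS
  refine ⟨Real.exp L, Real.exp_pos L, ?_, ?_⟩
  · have h1 : Tendsto S atTop (nhds L) := by
      rw [tendsto_iff_norm_sub_tendsto_zero]
      have h2 := tendsto_inv_log_natCast.const_mul C₁
      rw [mul_zero] at h2
      refine tendsto_of_tendsto_of_tendsto_of_le_of_le' tendsto_const_nhds h2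
        (Eventually.of_forall fun _ => norm_nonneg _) ?_
      filter_upwards [eventually_ge_atTop 2] with N hN using hL N hN
    refine ((Real.continuous_exp.tendsto L).comp
      (h1.comp (tendsto_add_atTop_nat 1))).congr fun Y => ?_
    rw [prod_primesUpTo_zpow_eq_exp _ Y.cast_nonneg, Nat.floor_natCast]
    simp only [Function.comp, hS]
    push_cast
    rfl
  · set K : ℝ := |κ / q.totient| * (|C₂| + |C₁|) with hK
    refine ⟨K * Real.exp K, fun X hX => ?_⟩
    have hlog := one_le_log_of_three_le hX
    have hlog0 : 0 < Real.log X := by linarith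
    have hX2 : 2 ≤ X := by linarith
    have hN : 2 ≤ ⌊X⌋₊ + 1 := by have := Nat.le_floor (n := 2) (by exact_mod_cast hX2); omega
    set M : ℝ := ∑ n ∈ range (⌊X⌋₊ + 1), if n.Prime then Real.log (1 - 1 / (n : ℝ)) else 0 with hMd
    set T : ℝ := ∑ n ∈ range (⌊X⌋₊ + 1), if n.Prime then
      (if (n : ZMod q) = a then 1 else 0) * Real.log (1 - 1 / (n : ℝ)) else 0 with hT
    have hMST : q.totient * T = M - S (⌊X⌋₊ + 1) := by
      simp only [hT, hMd, hS]
      rw [mul_sum, ← sum_sub_distrib]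
      refine sum_congr rfl fun n _ => ?_
      by_cases hp : n.Prime
      · simp only [hp, if_true]
        ring
      · simp only [hp, if_false]
        ring
    have h1 : |M + Real.log (Real.log X) + Real.eulerMascheroniConstant| ≤ |C₂| / Real.log X :=
      (hM X hX2).trans (div_le_div_of_nonneg_right (le_abs_self _) hlog0.le)
    have h2 : |S (⌊X⌋₊ + 1) - L| ≤ |C₁| / Real.log X := by
      refine (hL _ hN).trans ?_
      rw [div_eq_mul_inv]
      have h3 := inv_log_floor_succ_le hX2
      refine mul_le_mul (le_abs_self _) h3 ?_ (abs_nonneg _)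
      exact inv_nonneg.mpr (Real.log_natCast_nonneg _)
    set R : ℝ := -(κ / q.totient) * ((M + Real.log (Real.log X) + Real.eulerMascheroniConstant)
      - (S (⌊X⌋₊ + 1) - L)) with hR
    have hRK : |R| ≤ K / Real.log X := by
      rw [hR, abs_mul, abs_neg, hK, mul_div_assoc, add_div]
      exact mul_le_mul_of_nonneg_left ((abs_sub _ _).trans (add_le_add h1 h2)) (abs_nonneg _)
    have hK0 : 0 ≤ K := by positivity
    refine ⟨Real.exp R - 1, ?_, ?_⟩
    · refine (abs_exp_sub_one_le_abs_mul_exp R).trans ?_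
      rw [mul_div_right_comm]
      refine mul_le_mul hRK (Real.exp_le_exp.mpr (hRK.trans (div_le_self hK0 hlog)))
        (Real.exp_pos _).le (by positivity)
    · rw [prod_filter_primesUpTo_rpow_eq_exp (fun p : ℕ => (p : ZMod q) = a) κ
          (by linarith : 0 ≤ X), add_sub_cancel, ← Real.exp_add,
        Real.rpow_def_of_pos (by positivity), ← Real.exp_add, Real.log_mul (Real.exp_pos _).ne'
        hlog0.ne', Real.log_exp]
      congr 1
      have h4 : T = (M - S (⌊X⌋₊ + 1)) / q.totient := by
        rw [← hMST]
        field_simp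
      rw [← hT, h4, hR]
      field_simp
      ring
end

section
/- Let a, q ≥ 1 be fixed integers with gcd(a,q) = 1 and 1 ≤ a ≤ q, and set α = a/q. Then, unconditionally, ∫_T^{2T} |ζ(1/2+it, α)|² dt = (q/φ(q)²) · Σ_χ ∫_T^{2T} |L(1/2+it, χ)|² dt + E(T), where the sum runs over all Dirichlet characters χ modulo q, φ is Euler's totient function, and E(T)/(T log T) → 0 as T → ∞. -/
open Complex Filter MeasureTheory Finset HurwitzZeta
open scoped ArithmeticFunction Real Classical

open FourierTransform in
theorem ae_eq_fourier_toLp {f : ℝ → ℂ} (hf : Integrable f) (hf2 : MemLp f 2) :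
    ((𝓕 (hf2.toLp f) : Lp ℂ 2 (volume : Measure ℝ)) : ℝ → ℂ) =ᵐ[volume] 𝓕 f := by
  have hcont : Continuous (𝓕 f) :=
    VectorFourier.fourierIntegral_continuous Real.continuous_fourierChar
      (by exact continuous_inner) hf
  refine ae_eq_of_integral_contDiff_smul_eq
    ((Lp.memLp _).locallyIntegrable (by norm_num)) hcont.locallyIntegrable fun g hg hgc => ?_
  have hg₁ : HasCompactSupport (Complex.ofRealCLM ∘ g) := hgc.comp_left rfl
  have hg₂ : ContDiff ℝ ((⊤ : ℕ∞) : WithTop ℕ∞) (Complex.ofRealCLM ∘ g) := by fun_prop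
  set φ : SchwartzMap ℝ ℂ := hg₁.toSchwartzMap hg₂
  have hφ : ∀ x, φ x = (g x : ℂ) := fun x => rfl
  have h₁ := DFunLike.congr_fun (Lp.fourier_toTemperedDistribution_eq (hf2.toLp f)) φ
  rw [TemperedDistribution.fourier_apply, Lp.toTemperedDistribution_apply,
    Lp.toTemperedDistribution_apply] at h₁
  have h₂ : ∫ x, (𝓕 φ) x • (hf2.toLp f) x = ∫ x, (𝓕 φ) x • f x :=
    integral_congr_ae (by filter_upwards [hf2.coeFn_toLp] with x hx; rw [hx])
  have h₃ : ∫ x, 𝓕 (φ : ℝ → ℂ) x • f x = ∫ x, φ x • 𝓕 f x := by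
    have := VectorFourier.integral_fourierIntegral_smul_eq_flip (L := innerₗ ℝ) (μ := volume)
      (ν := volume) Real.continuous_fourierChar (by exact continuous_inner) φ.integrable hf
    rwa [flip_innerₗ] at this
  rw [h₂, SchwartzMap.fourier_coe, h₃] at h₁
  simpa [hφ] using h₁.symm

open FourierTransform in
theorem integral_norm_sq_fourier {f : ℝ → ℂ} (hf : Integrable f) (hf2 : MemLp f 2) :
    Integrable (fun ξ => ‖𝓕 f ξ‖ ^ 2) ∧ ∫ ξ, ‖𝓕 f ξ‖ ^ 2 = ∫ x, ‖f x‖ ^ 2 := by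
  have hae := ae_eq_fourier_toLp hf hf2
  have hF : MemLp (𝓕 f) 2 := (memLp_congr_ae hae).1 (Lp.memLp _)
  refine ⟨hF.integrable_norm_pow (by norm_num), ?_⟩
  have h := Lp.norm_fourier_eq (hf2.toLp f)
  rw [Lp.norm_def, Lp.norm_def, eLpNorm_congr_ae hae, eLpNorm_congr_ae hf2.coeFn_toLp,
    hF.eLpNorm_eq_integral_rpow_norm (by norm_num) (by norm_num),
    hf2.eLpNorm_eq_integral_rpow_norm (by norm_num) (by norm_num)] at h
  simp only [ENNReal.toReal_ofNat, Real.rpow_two] at h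
  rw [ENNReal.toReal_ofReal (by positivity), ENNReal.toReal_ofReal (by positivity)] at h
  exact (Real.rpow_left_inj (by positivity) (by positivity) (by norm_num)).1 h

/-- The weight `1 - {x - β}` on `x > β`, extended by zero. -/
noncomputable def sawTail (β x : ℝ) : ℂ :=
  (Set.Ioi β).indicator (fun y => ((1 - Int.fract (y - β) : ℝ) : ℂ)) x

theorem measurable_sawTail (β : ℝ) : Measurable (sawTail β) := by
  unfold sawTail
  refine Measurable.indicator ?_ measurableSet_Ioi
  exact Complex.measurable_ofReal.comp
    (measurable_const.sub (measurable_fract.comp (measurable_id.sub_const β)))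

theorem norm_sawTail_le (β x : ℝ) : ‖sawTail β x‖ ≤ (Set.Ioi β).indicator 1 x := by
  unfold sawTail
  by_cases hx : x ∈ Set.Ioi β
  · rw [Set.indicator_of_mem hx, Set.indicator_of_mem hx, Complex.norm_real, Real.norm_eq_abs,
      Pi.one_apply, abs_le]
    constructor <;> linarith [Int.fract_nonneg (x - β), Int.fract_lt_one (x - β)]
  · simp [Set.indicator_of_notMem hx]

theorem norm_sawTail_le_one (β x : ℝ) : ‖sawTail β x‖ ≤ 1 :=
  (norm_sawTail_le β x).trans (Set.indicator_le_self' (fun _ _ => zero_le_one) x)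

theorem sawTail_of_le {β x : ℝ} (hx : x ≤ β) : sawTail β x = 0 :=
  Set.indicator_of_notMem (by simpa using hx) _

theorem sawTail_add_nat {β x : ℝ} {n : ℕ} (hx : β + n < x) (hx' : x < β + n + 1) :
    sawTail β x = ((β + n + 1 - x : ℝ) : ℂ) := by
  have hfl : Int.fract (x - β) = x - β - n := by
    rw [Int.fract, (Int.floor_eq_iff (z := (n : ℤ))).2 ⟨by push_cast; linarith, by push_cast; linarith⟩]
    simp
  have hn : (0 : ℝ) ≤ n := n.cast_nonneg
  rw [sawTail, Set.indicator_of_mem (by simp only [Set.mem_Ioi]; linarith), hfl]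
  congr 1
  ring

theorem differentiableAt_mellin_sawTail {β : ℝ} (hβ : 0 < β) {s : ℂ} (hs : s.re < 0) :
    DifferentiableAt ℂ (mellin (sawTail β)) s := by
  refine mellin_differentiableAt_of_isBigO_rpow (a := 0) (b := s.re - 1) ?_ ?_ hs ?_ (by linarith)
  · refine (LocallyIntegrable.locallyIntegrableOn ?_ _)
    exact (locallyIntegrable_const (1 : ℝ)).mono (measurable_sawTail β).aestronglyMeasurable
      (Eventually.of_forall fun x => by simpa using norm_sawTail_le_one β x)
  · refine Asymptotics.IsBigO.of_bound 1 (Eventually.of_forall fun x => ?_)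
    simpa using norm_sawTail_le_one β x
  · refine Asymptotics.IsBigO.of_bound 1 ?_
    filter_upwards [nhdsWithin_le_nhds (Iio_mem_nhds hβ)] with x hx
    rw [sawTail_of_le (le_of_lt hx)]
    simp

theorem mellin_sawTail_eq {β : ℝ} (hβ : 0 < β) (s : ℂ) :
    mellin (sawTail β) s = ∫ x in Set.Ioi β, (x : ℂ) ^ (s - 1) * sawTail β x := by
  rw [mellin, ← setIntegral_eq_of_subset_of_forall_sdiff_eq_zero measurableSet_Ioi
    (Set.Ioi_subset_Ioi hβ.le)]
  · simp [smul_eq_mul]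
  · intro x hx
    rw [sawTail_of_le (by simpa using hx.2), mul_zero]

theorem integrableOn_cpow_mul_sawTail {β : ℝ} (hβ : 0 < β) {s : ℂ} (hs : s.re < 0) :
    IntegrableOn (fun x : ℝ => (x : ℂ) ^ (s - 1) * sawTail β x) (Set.Ioi β) := by
  refine Integrable.mul_bdd (c := 1) ?_ (measurable_sawTail β).aestronglyMeasurable
    (Eventually.of_forall fun x => norm_sawTail_le_one β x)
  exact integrableOn_Ioi_cpow_of_lt (by simp; linarith) hβ

theorem integral_sub_mul_cpow {c : ℝ} (hc : 0 < c) {s : ℂ} (hs : s ≠ 1) :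
    s * ∫ x in c..(c + 1), (x : ℂ) ^ (-s - 1) * ((c + 1 - x : ℝ) : ℂ) =
      (c : ℂ) ^ (-s) - (((c + 1 : ℝ) : ℂ) ^ (1 - s) - (c : ℂ) ^ (1 - s)) / (1 - s) := by
  have hs' : 1 - s ≠ 0 := sub_ne_zero.2 hs.symm
  have hpos : ∀ x ∈ Set.uIcc c (c + 1), 0 < x := fun x hx => by
    rw [Set.uIcc_of_le (by linarith)] at hx
    exact hc.trans_le hx.1
  have hderiv : ∀ x ∈ Set.uIcc c (c + 1), HasDerivAt
      (fun x : ℝ => -((c + 1 - x : ℝ) : ℂ) * (x : ℂ) ^ (-s) - (x : ℂ) ^ (1 - s) / (1 - s))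
      (s * ((x : ℂ) ^ (-s - 1) * ((c + 1 - x : ℝ) : ℂ))) x := by
    intro x hx
    have hx0 := hpos x hx
    have hslit : (x : ℂ) ∈ slitPlane := ofReal_mem_slitPlane.2 hx0
    have h₁ : HasDerivAt (fun x : ℝ => (x : ℂ) ^ (-s)) (-s * (x : ℂ) ^ (-s - 1)) x := by
      simpa using ((hasDerivAt_id (x : ℂ)).cpow_const (c := -s) hslit).comp_ofReal
    have h₂ : HasDerivAt (fun x : ℝ => (x : ℂ) ^ (1 - s)) ((1 - s) * (x : ℂ) ^ (-s)) x := by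
      simpa using ((hasDerivAt_id (x : ℂ)).cpow_const (c := 1 - s) hslit).comp_ofReal
    have h₃ : HasDerivAt (fun x : ℝ => -((c + 1 - x : ℝ) : ℂ)) 1 x :=
      ((((hasDerivAt_id x).const_sub (c + 1)).ofReal_comp).fun_neg).congr_deriv (by simp)
    refine ((h₃.mul h₁).sub (h₂.div_const (1 - s))).congr_deriv ?_
    field_simp
    ring
  have hcont : ContinuousOn (fun x : ℝ => s * ((x : ℂ) ^ (-s - 1) * ((c + 1 - x : ℝ) : ℂ)))
      (Set.uIcc c (c + 1)) := by
    refine continuousOn_const.mul (ContinuousOn.mul ?_ (by fun_prop))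
    exact Complex.continuous_ofReal.continuousOn.cpow continuousOn_const
      fun x hx => ofReal_mem_slitPlane.2 (hpos x hx)
  rw [← intervalIntegral.integral_const_mul,
    intervalIntegral.integral_eq_sub_of_hasDerivAt hderiv hcont.intervalIntegrable]
  push_cast
  ring

theorem sum_cpow_eq_integral_sawTail {β : ℝ} (hβ : 0 < β) {s : ℂ} (hs : 0 < s.re) (hs1 : s ≠ 1)
    (K : ℕ) :
    ∑ n ∈ range K, ((β + n : ℝ) : ℂ) ^ (-s) =
      s * (∫ x in β..(β + K), (x : ℂ) ^ (-s - 1) * sawTail β x) +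
        (((β + K : ℝ) : ℂ) ^ (1 - s) - (β : ℂ) ^ (1 - s)) / (1 - s) := by
  induction K with
  | zero => simp
  | succ K ih =>
    have hK : 0 < β + K := by positivity
    have hint : ∀ a b : ℝ, β ≤ a → a ≤ b →
        IntervalIntegrable (fun x : ℝ => (x : ℂ) ^ (-s - 1) * sawTail β x) volume a b := by
      intro a b ha hab
      rw [intervalIntegrable_iff_integrableOn_Ioc_of_le hab]
      exact (integrableOn_cpow_mul_sawTail (s := -s) hβ (by simpa using hs)).mono_set
        fun x hx => lt_of_le_of_lt ha hx.1
    have hstep : ∫ x in (β + K)..(β + K + 1), (x : ℂ) ^ (-s - 1) * sawTail β x =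
        ∫ x in (β + K)..(β + K + 1), (x : ℂ) ^ (-s - 1) * ((β + K + 1 - x : ℝ) : ℂ) := by
      rw [intervalIntegral.integral_of_le (by linarith), intervalIntegral.integral_of_le (by linarith),
        integral_Ioc_eq_integral_Ioo, integral_Ioc_eq_integral_Ioo]
      refine setIntegral_congr_fun measurableSet_Ioo fun x hx => ?_
      simp only [sawTail_add_nat hx.1 hx.2]
    rw [sum_range_succ, ih, Nat.cast_succ, ← add_assoc,
      ← intervalIntegral.integral_add_adjacent_intervals (hint β (β + K) le_rfl (by simp))
        (hint (β + K) (β + K + 1) (by simp) (by linarith)), hstep, mul_add,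
      integral_sub_mul_cpow hK hs1]
    ring

theorem tendsto_sum_cpow_sawTail {β : ℝ} (hβ : 0 < β) {s : ℂ} (hs : 1 < s.re) :
    Tendsto (fun K : ℕ => ∑ n ∈ range K, ((β + n : ℝ) : ℂ) ^ (-s)) atTop
      (nhds (s * mellin (sawTail β) (-s) + (β : ℂ) ^ (1 - s) / (s - 1))) := by
  have hs1 : s ≠ 1 := by rintro rfl; simp at hs
  have hK : Tendsto (fun K : ℕ => β + (K : ℝ)) atTop atTop :=
    tendsto_atTop_add_const_left _ _ tendsto_natCast_atTop_atTop
  simp_rw [sum_cpow_eq_integral_sawTail hβ (by linarith : 0 < s.re) hs1]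
  have h₁ := intervalIntegral_tendsto_integral_Ioi β
    (integrableOn_cpow_mul_sawTail (s := -s) hβ (by simp; linarith)) hK
  rw [← mellin_sawTail_eq hβ] at h₁
  have h₂ : Tendsto (fun K : ℕ => ((β + K : ℝ) : ℂ) ^ (1 - s)) atTop (nhds 0) := by
    rw [tendsto_zero_iff_norm_tendsto_zero]
    have : Tendsto (fun K : ℕ => (β + (K : ℝ)) ^ (-(s.re - 1))) atTop (nhds 0) :=
      (tendsto_rpow_neg_atTop (by linarith)).comp hK
    refine this.congr fun K => ?_
    rw [Complex.norm_cpow_eq_rpow_re_of_pos (by positivity)]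
    simp
  have h₃ := (h₁.const_mul s).add ((h₂.sub_const ((β : ℂ) ^ (1 - s))).div_const (1 - s))
  convert h₃ using 2
  rw [zero_sub, neg_div, ← div_neg, neg_sub]

theorem hurwitzZeta_eq_sum_add_mellin {α : ℝ} (hα : 0 < α) (hα1 : α ≤ 1) (N : ℕ) {s : ℂ}
    (hs : 0 < s.re) (hs' : 0 < s.im) :
    hurwitzZeta (α : UnitAddCircle) s =
      ∑ n ∈ range N, ((α + n : ℝ) : ℂ) ^ (-s) +
        (((α + N : ℝ) : ℂ) ^ (1 - s) / (s - 1) + s * mellin (sawTail (α + N)) (-s)) := by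
  set U : Set ℂ := {s | 0 < s.re} ∩ {s | 0 < s.im}
  have hUo : IsOpen U := (isOpen_lt continuous_const continuous_re).inter
    (isOpen_lt continuous_const continuous_im)
  have hUc : IsPreconnected U :=
    ((convex_halfSpace_re_gt 0).inter (convex_halfSpace_im_gt 0)).isPreconnected
  have hU1 : ∀ z ∈ U, z ≠ 1 := by rintro z hz rfl; simpa using hz.2
  have hβ : 0 < α + N := by positivity
  have hpos : ∀ n : ℕ, ((α + n : ℝ) : ℂ) ≠ 0 := fun n => by
    exact_mod_cast (by positivity : (0 : ℝ) < α + n).ne'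
  have hf : AnalyticOnNhd ℂ (hurwitzZeta (α : UnitAddCircle)) U :=
    DifferentiableOn.analyticOnNhd
      (fun z hz => (differentiableAt_hurwitzZeta _ (hU1 z hz)).differentiableWithinAt) hUo
  have hg : AnalyticOnNhd ℂ (fun s : ℂ => ∑ n ∈ range N, ((α + n : ℝ) : ℂ) ^ (-s) +
      (((α + N : ℝ) : ℂ) ^ (1 - s) / (s - 1) + s * mellin (sawTail (α + N)) (-s))) U := by
    refine DifferentiableOn.analyticOnNhd (fun z hz => DifferentiableAt.differentiableWithinAt ?_) hUo
    refine DifferentiableAt.add (DifferentiableAt.fun_sum fun n _ => ?_) (DifferentiableAt.add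
      (DifferentiableAt.div ?_ (by fun_prop) (sub_ne_zero.2 (hU1 z hz)))
      (DifferentiableAt.mul (by fun_prop) ?_))
    · exact (differentiableAt_id.neg).const_cpow (Or.inl (hpos n))
    · exact (differentiableAt_id.const_sub 1).const_cpow (Or.inl (hpos N))
    · exact (differentiableAt_mellin_sawTail hβ (by simpa using hz.1)).comp z
        (differentiableAt_id.neg)
  have hz₀ : (2 + I : ℂ) ∈ U := by simp [U]
  refine hf.eqOn_of_preconnected_of_eventuallyEq hg hUc hz₀ ?_ ⟨hs, hs'⟩
  have hV : {z : ℂ | 1 < z.re} ∈ nhds (2 + I : ℂ) :=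
    (isOpen_lt continuous_const continuous_re).mem_nhds (by simp)
  filter_upwards [hV] with z hz
  have h₁ := (hasSum_hurwitzZeta_of_one_lt_re ⟨hα.le, hα1⟩ hz).tendsto_sum_nat
  have h₂ := (tendsto_sum_cpow_sawTail hβ hz).const_add (∑ n ∈ range N, ((α + n : ℝ) : ℂ) ^ (-z))
  refine (tendsto_nhds_unique (h₁.comp (tendsto_add_atTop_nat N)) (h₂.congr fun K => ?_)).trans ?_
  · simp only [Function.comp_apply, add_comm K N]
    rw [sum_range_add]
    congr 1 <;> refine sum_congr rfl fun n _ => ?_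
    all_goals
      rw [Complex.cpow_neg, one_div]
      congr 2
      push_cast
      ring
  · ring

open FourierTransform in
theorem integral_norm_sq_mellin_sawTail_le {β : ℝ} (hβ : 0 < β) :
    Integrable (fun t : ℝ => ‖mellin (sawTail β) (-(1 / 2 + t * I))‖ ^ 2) ∧
      ∫ t : ℝ, ‖mellin (sawTail β) (-(1 / 2 + t * I))‖ ^ 2 ≤ 2 * π / β := by
  set h : ℝ → ℂ := fun u => Real.exp (1 / 2 * u) • sawTail β (Real.exp (-u)) with hh
  have hmeas : AEStronglyMeasurable h volume :=
    ((by fun_prop : Measurable fun u : ℝ => Real.exp (1 / 2 * u)).smul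
      ((measurable_sawTail β).comp (by fun_prop : Measurable fun u : ℝ => Real.exp (-u)))).aestronglyMeasurable
  have hbound : ∀ u, ‖h u‖ ≤ (Set.Iic (-Real.log β)).indicator (fun u => Real.exp (1 / 2 * u)) u := by
    intro u
    rw [hh, norm_smul, Real.norm_eq_abs, Real.abs_exp]
    by_cases hu : u ∈ Set.Iic (-Real.log β)
    · rw [Set.indicator_of_mem hu]
      exact mul_le_of_le_one_right (Real.exp_pos _).le (norm_sawTail_le_one _ _)
    · rw [Set.indicator_of_notMem hu, sawTail_of_le, norm_zero, mul_zero]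
      rw [← Real.le_log_iff_exp_le hβ]
      simp only [Set.mem_Iic, not_le] at hu
      linarith
  have hsq : ∀ u, ‖h u‖ ^ 2 ≤ (Set.Iic (-Real.log β)).indicator Real.exp u := by
    intro u
    refine (pow_le_pow_left₀ (norm_nonneg _) (hbound u) 2).trans ?_
    by_cases hu : u ∈ Set.Iic (-Real.log β)
    · rw [Set.indicator_of_mem hu, Set.indicator_of_mem hu, ← Real.exp_nat_mul]
      apply le_of_eq
      congr 1
      push_cast
      ring
    · simp [Set.indicator_of_notMem hu]
  have hexp : Integrable ((Set.Iic (-Real.log β)).indicator Real.exp) :=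
    (integrable_indicator_iff measurableSet_Iic).2 (integrableOn_exp_Iic _)
  have hint : Integrable h :=
    Integrable.mono' ((integrable_indicator_iff measurableSet_Iic).2
      (integrableOn_exp_mul_Iic (by norm_num) _)) hmeas (Eventually.of_forall hbound)
  have hint2 : MemLp h 2 := by
    refine (memLp_two_iff_integrable_sq_norm hmeas).2 (hexp.mono' (hmeas.norm.pow 2) ?_)
    exact Eventually.of_forall fun u => by simpa using hsq u
  obtain ⟨hF, hFeq⟩ := integral_norm_sq_fourier hint hint2
  have heq : (fun t : ℝ => ‖mellin (sawTail β) (-(1 / 2 + t * I))‖ ^ 2) =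
      fun t => (fun ξ => ‖𝓕 h ξ‖ ^ 2) (-(2 * π)⁻¹ * t) := by
    funext t
    have h₁ : (fun u : ℝ => Real.exp (-(-(1 / 2 + t * I) : ℂ).re * u) •
        sawTail β (Real.exp (-u))) = h := by
      funext u
      simp [hh]
    have h₂ : (-(1 / 2 + t * I) : ℂ).im / (2 * π) = -(2 * π)⁻¹ * t := by
      simp
      ring
    rw [mellin_eq_fourier, h₁, h₂]
  rw [heq]
  refine ⟨hF.comp_mul_left' (by simp [Real.pi_ne_zero]), ?_⟩
  rw [Measure.integral_comp_mul_left (fun ξ => ‖𝓕 h ξ‖ ^ 2) (-(2 * π)⁻¹), hFeq]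
  have hle : ∫ u, ‖h u‖ ^ 2 ≤ β⁻¹ := by
    refine (integral_mono (hint2.integrable_norm_pow (by norm_num)) hexp hsq).trans ?_
    rw [integral_indicator measurableSet_Iic, integral_exp_Iic, Real.exp_neg, Real.exp_log hβ]
  have habs : |(-(2 * π)⁻¹)⁻¹| = 2 * π := by
    rw [inv_neg, inv_inv, abs_neg, abs_of_pos Real.two_pi_pos]
  rw [habs, smul_eq_mul, div_eq_mul_inv]
  exact mul_le_mul_of_nonneg_left hle Real.two_pi_pos.le

theorem normSq_sum_cpow (x : ℕ → ℝ) (hx : ∀ n, 0 < x n) (N : ℕ) (t : ℝ) :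
    ‖∑ n ∈ range N, (x n : ℂ) ^ (-(1 / 2 + t * I))‖ ^ 2 =
      ∑ m ∈ range N, ∑ n ∈ range N,
        (√(x m))⁻¹ * (√(x n))⁻¹ * Real.cos (t * (Real.log (x m) - Real.log (x n))) := by
  have hz : ∀ n, (x n : ℂ) ^ (-(1 / 2 + t * I)) =
      (((√(x n))⁻¹ * Real.cos (t * Real.log (x n)) : ℝ) : ℂ) +
        ((-((√(x n))⁻¹ * Real.sin (t * Real.log (x n))) : ℝ) : ℂ) * I := by
    intro n
    have hne : (x n : ℂ) ≠ 0 := by exact_mod_cast (hx n).ne'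
    have hexp : (√(x n))⁻¹ = Real.exp (-(Real.log (x n) / 2)) := by
      rw [Real.exp_neg, ← Real.log_sqrt (hx n).le, Real.exp_log (Real.sqrt_pos.2 (hx n))]
    have harg : (Real.log (x n) : ℂ) * -(1 / 2 + t * I) =
        ((-(Real.log (x n) / 2) : ℝ) : ℂ) + ((-(t * Real.log (x n)) : ℝ) : ℂ) * I := by
      push_cast
      ring
    rw [Complex.cpow_def_of_ne_zero hne, ← Complex.ofReal_log (hx n).le, harg, Complex.exp_add,
      Complex.exp_mul_I, ← Complex.ofReal_exp, ← Complex.ofReal_cos, ← Complex.ofReal_sin,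
      Real.cos_neg, Real.sin_neg, hexp]
    push_cast
    ring
  have hsum : ∑ n ∈ range N, (x n : ℂ) ^ (-(1 / 2 + t * I)) =
      ((∑ n ∈ range N, (√(x n))⁻¹ * Real.cos (t * Real.log (x n)) : ℝ) : ℂ) +
        ((∑ n ∈ range N, -((√(x n))⁻¹ * Real.sin (t * Real.log (x n))) : ℝ) : ℂ) * I := by
    simp_rw [hz, sum_add_distrib, ← sum_mul, Complex.ofReal_sum]
  rw [hsum, ← Complex.normSq_eq_norm_sq, Complex.normSq_add_mul_I, sq, sq, sum_mul_sum, sum_mul_sum,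
    ← sum_add_distrib]
  refine sum_congr rfl fun m _ => ?_
  rw [← sum_add_distrib]
  refine sum_congr rfl fun n _ => ?_
  rw [mul_sub, Real.cos_sub]
  ring

theorem abs_integral_cos_le (T : ℝ) {c : ℝ} (hc : c ≠ 0) :
    |∫ t in T..(2 * T), Real.cos (t * c)| ≤ 2 / |c| := by
  rw [intervalIntegral.integral_comp_mul_right _ hc, integral_cos, smul_eq_mul, abs_mul, abs_inv,
    div_eq_mul_inv, mul_comm]
  gcongr
  rw [abs_le]
  constructor <;> linarith [Real.neg_one_le_sin (2 * T * c), Real.sin_le_one (2 * T * c),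
    Real.neg_one_le_sin (T * c), Real.sin_le_one (T * c)]

theorem inv_sqrt_mul_inv_sqrt_mul_le_aux {x y : ℝ} (hx : 0 < x) (hxy : x < y) :
    (√x)⁻¹ * (√y)⁻¹ * (2 / |Real.log x - Real.log y|) ≤ 2 * (x⁻¹ + |x - y|⁻¹) := by
  have hy : 0 < y := hx.trans hxy
  have hd : 0 < y - x := sub_pos.2 hxy
  have hlog : (y - x) / y ≤ Real.log y - Real.log x := by
    have := Real.one_sub_inv_le_log_of_pos (div_pos hy hx)
    rw [Real.log_div hy.ne' hx.ne', inv_div] at this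
    rwa [sub_div, div_self hy.ne']
  have hl : 0 < (y - x) / y := div_pos hd hy
  have hsqrt : (√x)⁻¹ * (√y)⁻¹ ≤ x⁻¹ := by
    rw [← mul_inv]
    refine inv_anti₀ hx ?_
    calc x = √x * √x := (Real.mul_self_sqrt hx.le).symm
      _ ≤ √x * √y := by gcongr
  have hpos : 0 < Real.log y - Real.log x := hl.trans_le hlog
  rw [abs_sub_comm, abs_of_pos hpos, abs_sub_comm, abs_of_pos hd]
  calc (√x)⁻¹ * (√y)⁻¹ * (2 / (Real.log y - Real.log x)) ≤ x⁻¹ * (2 / ((y - x) / y)) := by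
        gcongr
    _ = 2 * (x⁻¹ + (y - x)⁻¹) := by
        field_simp
        ring

theorem inv_sqrt_mul_inv_sqrt_mul_le {x y : ℝ} (hx : 0 < x) (hy : 0 < y) (hxy : x ≠ y) :
    (√x)⁻¹ * (√y)⁻¹ * (2 / |Real.log x - Real.log y|) ≤ 2 * (x⁻¹ + y⁻¹ + |x - y|⁻¹) := by
  rcases lt_or_gt_of_ne hxy with h | h
  · have := inv_sqrt_mul_inv_sqrt_mul_le_aux hx h
    have := inv_pos.2 hy
    linarith
  · have := inv_sqrt_mul_inv_sqrt_mul_le_aux hy h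
    rw [abs_sub_comm x, abs_sub_comm (Real.log x), mul_comm (√x)⁻¹]
    have := inv_pos.2 hx
    linarith

theorem sum_inv_abs_sub_le (N m : ℕ) (hm : m < N) :
    ∑ n ∈ range N, |(m : ℝ) - n|⁻¹ ≤ 2 * (harmonic N : ℝ) := by
  have hmono : ∀ k ≤ N, ∑ i ∈ range k, ((i : ℝ) + 1)⁻¹ ≤ harmonic N := by
    intro k hk
    rw [harmonic]
    push_cast
    exact sum_le_sum_of_subset_of_nonneg (range_subset_range.2 hk) fun _ _ _ => by positivity
  obtain ⟨d, rfl⟩ := Nat.exists_eq_add_of_lt hm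
  rw [add_assoc m d 1, sum_range_add, sum_range_succ']
  have h₁ : ∑ n ∈ range m, |(m : ℝ) - n|⁻¹ ≤ harmonic (m + (d + 1)) := by
    rw [← sum_range_reflect]
    refine le_of_eq_of_le (sum_congr rfl fun i hi => ?_) (hmono m (by omega))
    have hi' : i < m := mem_range.1 hi
    rw [Nat.sub_sub, Nat.cast_sub (by omega)]
    push_cast
    rw [sub_sub_cancel, abs_of_pos (by positivity), add_comm]
  have h₂ : ∑ n ∈ range d, |(m : ℝ) - (m + (n + 1) : ℕ)|⁻¹ ≤ harmonic (m + (d + 1)) := by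
    refine le_of_eq_of_le (sum_congr rfl fun i _ => ?_) (hmono d (by omega))
    push_cast
    rw [abs_sub_comm, add_sub_cancel_left, abs_of_pos (by positivity)]
  simp only [add_zero, sub_self, abs_zero, inv_zero]
  linarith

theorem abs_integral_normSq_sum_cpow_sub_le {α : ℝ} (hα : 0 < α) (N : ℕ) (T : ℝ) :
    |(∫ t in T..(2 * T), ‖∑ n ∈ range N, ((α + n : ℝ) : ℂ) ^ (-(1 / 2 + t * I))‖ ^ 2) -
        T * ∑ n ∈ range N, (α + n : ℝ)⁻¹| ≤
      4 * N * (∑ n ∈ range N, (α + n : ℝ)⁻¹ + harmonic N) := by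
  set x : ℕ → ℝ := fun n => α + n with hxdef
  have hx : ∀ n, 0 < x n := fun n => by positivity
  have hinj : ∀ {m n}, m ≠ n → x m ≠ x n := fun h h' => h (by simpa [hxdef] using h')
  set J : ℕ → ℕ → ℝ := fun m n =>
    ∫ t in T..(2 * T), (√(x m))⁻¹ * (√(x n))⁻¹ * Real.cos (t * (Real.log (x m) - Real.log (x n)))
  have hint : ∀ m n, IntervalIntegrable (fun t => (√(x m))⁻¹ * (√(x n))⁻¹ *
      Real.cos (t * (Real.log (x m) - Real.log (x n)))) volume T (2 * T) := fun m n =>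
    (by fun_prop : Continuous fun t => (√(x m))⁻¹ * (√(x n))⁻¹ *
      Real.cos (t * (Real.log (x m) - Real.log (x n)))).intervalIntegrable _ _
  have hI : (∫ t in T..(2 * T), ‖∑ n ∈ range N, (x n : ℂ) ^ (-(1 / 2 + t * I))‖ ^ 2) =
      ∑ m ∈ range N, ∑ n ∈ range N, J m n := by
    simp_rw [normSq_sum_cpow x hx]
    rw [intervalIntegral.integral_finsetSum fun m _ =>
      (by fun_prop : Continuous fun t => ∑ n ∈ range N, (√(x m))⁻¹ * (√(x n))⁻¹ *
        Real.cos (t * (Real.log (x m) - Real.log (x n)))).intervalIntegrable _ _]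
    exact sum_congr rfl fun m _ => intervalIntegral.integral_finsetSum fun n _ => hint m n
  have hdiag : ∀ m, J m m = T * (x m)⁻¹ := by
    intro m
    have h : (√(x m))⁻¹ * (√(x m))⁻¹ = (x m)⁻¹ := by rw [← mul_inv, Real.mul_self_sqrt (hx m).le]
    simp only [J, sub_self, mul_zero, Real.cos_zero, mul_one, h,
      intervalIntegral.integral_const, smul_eq_mul]
    ring
  have hoff : ∀ m n, |J m n - if m = n then T * (x m)⁻¹ else 0| ≤
      2 * ((x m)⁻¹ + (x n)⁻¹ + |(m : ℝ) - n|⁻¹) := by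
    intro m n
    have hm := inv_pos.2 (hx m)
    have hn := inv_pos.2 (hx n)
    by_cases hmn : m = n
    · subst hmn
      rw [if_pos rfl, hdiag, sub_self, abs_zero]
      positivity
    · rw [if_neg hmn, sub_zero]
      have hlog : Real.log (x m) - Real.log (x n) ≠ 0 :=
        sub_ne_zero.2 fun h => hinj hmn (Real.log_injOn_pos (hx m) (hx n) h)
      have h := inv_sqrt_mul_inv_sqrt_mul_le (hx m) (hx n) (hinj hmn)
      have hsub : x m - x n = m - n := by simp [hxdef]
      rw [hsub] at h
      refine le_trans ?_ h
      simp only [J]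
      rw [intervalIntegral.integral_const_mul, abs_mul, abs_of_nonneg (by positivity)]
      exact mul_le_mul_of_nonneg_left (abs_integral_cos_le T hlog) (by positivity)
  have hD : T * ∑ n ∈ range N, (x n)⁻¹ =
      ∑ m ∈ range N, ∑ n ∈ range N, if m = n then T * (x m)⁻¹ else 0 := by
    rw [mul_sum]
    refine sum_congr rfl fun m hm => ?_
    rw [sum_ite_eq, if_pos hm]
  rw [hI, hD, ← sum_sub_distrib]
  simp_rw [← sum_sub_distrib]
  calc |∑ m ∈ range N, ∑ n ∈ range N, (J m n - if m = n then T * (x m)⁻¹ else 0)|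
      ≤ ∑ m ∈ range N, ∑ n ∈ range N, 2 * ((x m)⁻¹ + (x n)⁻¹ + |(m : ℝ) - n|⁻¹) :=
        (abs_sum_le_sum_abs _ _).trans (sum_le_sum fun m _ =>
          (abs_sum_le_sum_abs _ _).trans (sum_le_sum fun n _ => hoff m n))
    _ ≤ ∑ m ∈ range N, (2 * N * (x m)⁻¹ + 2 * ∑ n ∈ range N, (x n)⁻¹ + 4 * (harmonic N : ℝ)) := by
        refine sum_le_sum fun m hm => ?_
        have := sum_inv_abs_sub_le N m (mem_range.1 hm)
        rw [← mul_sum, sum_add_distrib, sum_add_distrib, sum_const, card_range, nsmul_eq_mul]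
        linarith
    _ = 4 * N * (∑ n ∈ range N, (x n)⁻¹ + harmonic N) := by
        rw [sum_add_distrib, sum_add_distrib, sum_const, sum_const, card_range, ← mul_sum]
        simp only [nsmul_eq_mul]
        ring

theorem intervalIntegrable_norm_sq {f : ℝ → ℂ} (hf : Continuous f) (a b : ℝ) :
    IntervalIntegrable (fun t => ‖f t‖ ^ 2) volume a b :=
  (hf.norm.pow 2).intervalIntegrable a b

theorem continuous_hurwitzZeta_half (x : UnitAddCircle) :
    Continuous fun t : ℝ => hurwitzZeta x (1 / 2 + t * I) := by
  refine continuous_iff_continuousAt.2 fun t => ?_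
  have hne : (1 / 2 + t * I : ℂ) ≠ 1 := fun h => by
    have := congrArg Complex.re h
    norm_num at this
  exact ContinuousAt.comp (f := fun t : ℝ => (1 / 2 + t * I : ℂ))
    (differentiableAt_hurwitzZeta x hne).continuousAt (by fun_prop)

theorem continuous_sum_cpow_half {α : ℝ} (hα : 0 < α) (N : ℕ) :
    Continuous fun t : ℝ => ∑ n ∈ range N, ((α + n : ℝ) : ℂ) ^ (-(1 / 2 + t * I)) := by
  refine continuous_finsetSum _ fun n _ => ?_
  have hne : ((α + n : ℝ) : ℂ) ≠ 0 := by
    exact_mod_cast (by positivity : (0 : ℝ) < α + n).ne'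
  exact (by fun_prop : Continuous fun t : ℝ => -(1 / 2 + t * I : ℂ)).const_cpow (Or.inl hne)

theorem norm_sq_hurwitzZeta_sub_sum_cpow_le {α : ℝ} (hα : 0 < α) (hα1 : α ≤ 1) (N : ℕ) {T t : ℝ}
    (hT : 1 ≤ T) (ht : T ≤ t) (ht' : t ≤ 2 * T) :
    ‖hurwitzZeta (α : UnitAddCircle) (1 / 2 + t * I) -
        ∑ n ∈ range N, ((α + n : ℝ) : ℂ) ^ (-(1 / 2 + t * I))‖ ^ 2 ≤
      2 * (α + N) / T ^ 2 + 10 * T ^ 2 * ‖mellin (sawTail (α + N)) (-(1 / 2 + t * I))‖ ^ 2 := by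
  have hT0 : 0 < T := by linarith
  have hβ : 0 < α + N := by positivity
  rw [hurwitzZeta_eq_sum_add_mellin hα hα1 N (by simp) (by simp; linarith), add_sub_cancel_left]
  set M := mellin (sawTail (α + N)) (-(1 / 2 + t * I))
  have hP : ‖((α + N : ℝ) : ℂ) ^ (1 - (1 / 2 + t * I)) / ((1 / 2 + t * I) - 1)‖ ^ 2 ≤
      (α + N) / T ^ 2 := by
    rw [norm_div, div_pow, Complex.norm_cpow_eq_rpow_re_of_pos hβ, ← Real.rpow_natCast,
      ← Real.rpow_mul hβ.le]
    have h1 : (1 - (1 / 2 + t * I) : ℂ).re * ((2 : ℕ) : ℝ) = 1 := by norm_num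
    rw [h1, Real.rpow_one, ← Complex.normSq_eq_norm_sq, Complex.normSq_apply]
    gcongr
    simp
    nlinarith
  have hs : ‖(1 / 2 + t * I : ℂ)‖ ^ 2 ≤ 5 * T ^ 2 := by
    rw [← Complex.normSq_eq_norm_sq, Complex.normSq_apply]
    simp
    nlinarith
  have hsM : ‖(1 / 2 + t * I : ℂ) * M‖ ^ 2 ≤ 5 * T ^ 2 * ‖M‖ ^ 2 := by
    rw [norm_mul, mul_pow]
    gcongr
  refine (pow_le_pow_left₀ (norm_nonneg _) (norm_add_le _ _) 2).trans ?_
  refine add_sq_le.trans ?_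
  rw [mul_div_assoc]
  linarith

theorem integral_norm_sq_hurwitzZeta_sub_sum_cpow_le {α : ℝ} (hα : 0 < α) (hα1 : α ≤ 1) (N : ℕ)
    {T : ℝ} (hT : 1 ≤ T) :
    ∫ t in T..(2 * T), ‖hurwitzZeta (α : UnitAddCircle) (1 / 2 + t * I) -
        ∑ n ∈ range N, ((α + n : ℝ) : ℂ) ^ (-(1 / 2 + t * I))‖ ^ 2 ≤
      2 * (α + N) / T + 20 * π * T ^ 2 / (α + N) := by
  have hT0 : 0 < T := by linarith
  have hβ : 0 < α + N := by positivity
  obtain ⟨hM, hMle⟩ := integral_norm_sq_mellin_sawTail_le hβ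
  refine (intervalIntegral.integral_mono_on (by linarith) (intervalIntegrable_norm_sq
    ((continuous_hurwitzZeta_half α).sub (continuous_sum_cpow_half hα N)) _ _)
    (intervalIntegrable_const.add (hM.intervalIntegrable.const_mul _)) fun t ht =>
      norm_sq_hurwitzZeta_sub_sum_cpow_le hα hα1 N hT ht.1 ht.2).trans ?_
  rw [intervalIntegral.integral_add intervalIntegrable_const (hM.intervalIntegrable.const_mul _),
    intervalIntegral.integral_const, intervalIntegral.integral_const_mul, smul_eq_mul]
  have hle : ∫ t in T..(2 * T), ‖mellin (sawTail (α + N)) (-(1 / 2 + t * I))‖ ^ 2 ≤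
      2 * π / (α + N) := by
    rw [intervalIntegral.integral_of_le (by linarith)]
    exact (setIntegral_le_integral hM (Eventually.of_forall fun _ => by positivity)).trans hMle
  calc _ ≤ (2 * T - T) * (2 * (α + N) / T ^ 2) + 10 * T ^ 2 * (2 * π / (α + N)) := by gcongr
    _ = _ := by
      field_simp
      ring

theorem abs_norm_sq_sub_norm_sq_le {E : Type*} [SeminormedAddCommGroup E] (x y : E) {η : ℝ}
    (hη : 0 < η) : |‖x‖ ^ 2 - ‖y‖ ^ 2| ≤ η * ‖y‖ ^ 2 + (1 + η⁻¹) * ‖x - y‖ ^ 2 := by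
  have h := abs_norm_sub_norm_le x y
  have hsum : ‖x‖ + ‖y‖ ≤ 2 * ‖y‖ + ‖x - y‖ := by linarith [le_abs_self (‖x‖ - ‖y‖)]
  have hsq : 0 ≤ η⁻¹ * (η * ‖y‖ - ‖x - y‖) ^ 2 := by positivity
  have hexp : η⁻¹ * (η * ‖y‖ - ‖x - y‖) ^ 2 =
      η * ‖y‖ ^ 2 - 2 * ‖y‖ * ‖x - y‖ + η⁻¹ * ‖x - y‖ ^ 2 := by
    field_simp
    ring
  calc |‖x‖ ^ 2 - ‖y‖ ^ 2| = |‖x‖ - ‖y‖| * (‖x‖ + ‖y‖) := by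
        rw [sq_sub_sq, abs_mul, abs_of_nonneg (by positivity : 0 ≤ ‖x‖ + ‖y‖), mul_comm]
    _ ≤ ‖x - y‖ * (2 * ‖y‖ + ‖x - y‖) := by gcongr
    _ ≤ _ := by nlinarith

theorem tendsto_of_abs_sub_le_mul_add {ι : Type*} {l : Filter ι} {a b c : ι → ℝ} {L : ℝ}
    (ha : Tendsto a l (nhds L)) (hb : Tendsto b l (nhds 0))
    (h : ∀ η > 0, ∀ᶠ i in l, |c i - a i| ≤ η * a i + (1 + η⁻¹) * b i) :
    Tendsto c l (nhds L) := by
  have hca : Tendsto (fun i => c i - a i) l (nhds 0) := by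
    rw [Metric.tendsto_nhds]
    intro ε hε
    have hη : 0 < ε / (|L| + 1) := by positivity
    have hlim : Tendsto (fun i => ε / (|L| + 1) * a i + (1 + (ε / (|L| + 1))⁻¹) * b i) l
        (nhds (ε / (|L| + 1) * L + (1 + (ε / (|L| + 1))⁻¹) * 0)) :=
      (ha.const_mul _).add (hb.const_mul _)
    have hlt : ε / (|L| + 1) * L + (1 + (ε / (|L| + 1))⁻¹) * 0 < ε := by
      rw [mul_zero, add_zero, div_mul_eq_mul_div, div_lt_iff₀ (by positivity)]
      nlinarith [le_abs_self L]
    filter_upwards [h _ hη, hlim.eventually_lt_const hlt] with i hi hi'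
    rw [Real.dist_eq, sub_zero]
    exact hi.trans_lt hi'
  simpa using hca.add ha

theorem harmonic_le_sum_inv_add {α : ℝ} (hα : 0 < α) (hα1 : α ≤ 1) (N : ℕ) :
    (harmonic N : ℝ) ≤ ∑ n ∈ range N, (α + n : ℝ)⁻¹ := by
  rw [harmonic]
  push_cast
  refine sum_le_sum fun n _ => inv_anti₀ (by positivity) ?_
  linarith

theorem sum_inv_add_le {α : ℝ} (hα : 0 < α) (N : ℕ) :
    ∑ n ∈ range N, (α + n : ℝ)⁻¹ ≤ α⁻¹ + 1 + Real.log N := by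
  cases N with
  | zero => simp; positivity
  | succ N =>
    have h : ∑ n ∈ range N, (α + (n + 1 : ℕ) : ℝ)⁻¹ ≤ harmonic N := by
      rw [harmonic]
      push_cast
      refine sum_le_sum fun n _ => inv_anti₀ (by positivity) ?_
      linarith
    have hlog : Real.log N ≤ Real.log (N + 1 : ℕ) := by
      rcases N.eq_zero_or_pos with rfl | hN
      · simp
      · exact Real.log_le_log (by exact_mod_cast hN) (by push_cast; linarith)
    have := harmonic_le_one_add_log N
    rw [sum_range_succ', Nat.cast_zero, add_zero]
    linarith

theorem sum_norm_sq_sum_char_mul {q : ℕ} [NeZero q] (f : ZMod q → ℂ) :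
    ∑ χ : DirichletCharacter ℂ q, ‖∑ j, χ j * f j‖ ^ 2 =
      q.totient * ∑ u : (ZMod q)ˣ, ‖f u‖ ^ 2 := by
  have hunits : ∀ χ : DirichletCharacter ℂ q,
      ∑ j, χ j * f j = ∑ u : (ZMod q)ˣ, χ u * f u := by
    intro χ
    rw [← sum_subset (s₁ := univ.image (Units.val : (ZMod q)ˣ → ZMod q)) (subset_univ _),
      sum_image fun u _ v _ h => Units.ext h]
    intro j _ hj
    rw [χ.map_nonunit, zero_mul]
    rintro ⟨u, rfl⟩
    exact hj (mem_image_of_mem _ (mem_univ u))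
  have hconj : ∀ (χ : DirichletCharacter ℂ q) (u : (ZMod q)ˣ),
      (starRingEnd ℂ) (χ u) = χ (u : ZMod q)⁻¹ := by
    intro χ u
    rw [starRingEnd_apply, MulChar.star_apply', MulChar.inv_apply, Ring.inverse_unit, ZMod.inv_coe_unit]
  have hℂ : (∑ χ : DirichletCharacter ℂ q, (‖∑ j, χ j * f j‖ ^ 2 : ℂ)) =
      q.totient * ∑ u : (ZMod q)ˣ, (‖f u‖ ^ 2 : ℂ) := by
    simp_rw [hunits, ← Complex.conj_mul', map_sum, map_mul, hconj, sum_mul_sum]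
    rw [sum_comm, mul_sum]
    refine sum_congr rfl fun u _ => ?_
    rw [sum_comm]
    have : ∀ v : (ZMod q)ˣ, ∑ χ : DirichletCharacter ℂ q,
        χ (u : ZMod q)⁻¹ * (starRingEnd ℂ) (f u) * (χ v * f v) =
          if u = v then q.totient * ((starRingEnd ℂ) (f u) * f u) else 0 := by
      intro v
      have h := DirichletCharacter.sum_char_inv_mul_char_eq ℂ u.isUnit (v : ZMod q)
      simp only [Units.val_inj] at h
      calc _ = (∑ χ : DirichletCharacter ℂ q, χ (u : ZMod q)⁻¹ * χ v) *
            ((starRingEnd ℂ) (f u) * f v) := by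
              rw [sum_mul]
              exact sum_congr rfl fun χ _ => by ring
        _ = _ := by
              rw [h]
              split_ifs with huv
              · rw [huv]
              · rw [zero_mul]
    rw [sum_congr rfl fun v _ => this v, sum_ite_eq, if_pos (mem_univ u)]
  exact_mod_cast hℂ

theorem sum_norm_sq_LFunction_half {q : ℕ} [NeZero q] (t : ℝ) :
    ∑ χ : DirichletCharacter ℂ q, ‖DirichletCharacter.LFunction χ (1 / 2 + t * I)‖ ^ 2 =
      q.totient / q * ∑ u : (ZMod q)ˣ,
        ‖hurwitzZeta (ZMod.toAddCircle (u : ZMod q)) (1 / 2 + t * I)‖ ^ 2 := by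
  have hq : 0 < (q : ℝ) := Nat.cast_pos.2 (NeZero.pos q)
  have hnorm : ‖(q : ℂ) ^ (-(1 / 2 + t * I))‖ ^ 2 = (q : ℝ)⁻¹ := by
    rw [Complex.norm_natCast_cpow_of_pos (NeZero.pos q), ← Real.rpow_natCast,
      ← Real.rpow_mul hq.le, ← Real.rpow_neg_one]
    congr 1
    simp
  simp_rw [DirichletCharacter.LFunction, ZMod.LFunction, norm_mul, mul_pow, hnorm, ← mul_sum]
  rw [sum_norm_sq_sum_char_mul]
  ring

/-- The length `⌈T / √(log T)⌉` of the Dirichlet polynomial approximating `ζ(1/2 + it, α)` in mean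
square on `[T, 2T]`. -/
noncomputable def polyLength (T : ℝ) : ℕ := ⌈T / √(Real.log T)⌉₊

theorem tendsto_log_log_div_log :
    Tendsto (fun T => Real.log (Real.log T) / Real.log T) atTop (nhds 0) :=
  Real.isLittleO_log_id_atTop.tendsto_div_nhds_zero.comp Real.tendsto_log_atTop

theorem tendsto_inv_sqrt_log : Tendsto (fun T => (√(Real.log T))⁻¹) atTop (nhds 0) :=
  tendsto_inv_atTop_zero.comp (Real.tendsto_sqrt_atTop.comp Real.tendsto_log_atTop)

theorem eventually_polyLength_le :
    ∀ᶠ T in atTop, (polyLength T : ℝ) ≤ 2 * T / √(Real.log T) := by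
  filter_upwards [eventually_ge_atTop 1, Real.tendsto_log_atTop.eventually_gt_atTop 0] with T hT hL
  have hsqrt : 0 < √(Real.log T) := Real.sqrt_pos.2 hL
  have h1 : 1 ≤ T / √(Real.log T) := by
    rw [one_le_div hsqrt, Real.sqrt_le_left (by linarith)]
    nlinarith [Real.log_le_sub_one_of_pos (by linarith : 0 < T)]
  have := (Nat.ceil_lt_add_one (by linarith : 0 ≤ T / √(Real.log T))).le
  rw [polyLength, mul_div_assoc]
  linarith

theorem tendsto_sum_inv_add_polyLength_div_log {α : ℝ} (hα : 0 < α) (hα1 : α ≤ 1) :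
    Tendsto (fun T => (∑ n ∈ range (polyLength T), (α + n : ℝ)⁻¹) / Real.log T) atTop (nhds 1) := by
  have hlo : Tendsto (fun T => 1 - 1 / 2 * (Real.log (Real.log T) / Real.log T)) atTop (nhds 1) := by
    simpa only [mul_zero, sub_zero] using (tendsto_log_log_div_log.const_mul (1 / 2)).const_sub 1
  have hhi : Tendsto (fun T => 1 + (α⁻¹ + 1) * (Real.log T)⁻¹) atTop (nhds 1) := by
    simpa using
      ((tendsto_inv_atTop_zero.comp Real.tendsto_log_atTop).const_mul (α⁻¹ + 1)).const_add 1
  refine tendsto_of_tendsto_of_tendsto_of_le_of_le' hlo hhi ?_ ?_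
  · filter_upwards [eventually_ge_atTop 1, Real.tendsto_log_atTop.eventually_gt_atTop 0] with T hT hL
    have hsqrt : 0 < √(Real.log T) := Real.sqrt_pos.2 hL
    have h := (log_add_one_le_harmonic (polyLength T)).trans (harmonic_le_sum_inv_add hα hα1 _)
    have hlog : Real.log T - 1 / 2 * Real.log (Real.log T) ≤
        Real.log (polyLength T + 1 : ℕ) := by
      calc Real.log T - 1 / 2 * Real.log (Real.log T) = Real.log (T / √(Real.log T)) := by
            rw [Real.log_div (by linarith) hsqrt.ne', Real.log_sqrt hL.le]
            ring
        _ ≤ _ := by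
            refine Real.log_le_log (by positivity) ((Nat.le_ceil _).trans ?_)
            exact_mod_cast Nat.le_succ _
    rw [le_div_iff₀ hL, sub_mul, one_mul, mul_assoc, div_mul_cancel₀ _ hL.ne']
    exact hlog.trans h
  · filter_upwards [eventually_ge_atTop 1, Real.tendsto_log_atTop.eventually_ge_atTop 4,
      eventually_polyLength_le] with T hT hL hN
    have hL0 : 0 < Real.log T := by linarith
    have hsqrt : 2 ≤ √(Real.log T) := Real.le_sqrt_of_sq_le (by linarith)
    have hNT : (polyLength T : ℝ) ≤ T := hN.trans <| by
      rw [div_le_iff₀ (by linarith)]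
      nlinarith
    have hN0 : 0 < (polyLength T : ℝ) :=
      (by positivity : 0 < T / √(Real.log T)).trans_le (Nat.le_ceil _)
    have h := sum_inv_add_le hα (polyLength T)
    have hlog := Real.log_le_log hN0 hNT
    rw [div_le_iff₀ hL0, add_mul, mul_assoc, inv_mul_cancel₀ hL0.ne']
    linarith

theorem tendsto_integral_norm_sq_sum_cpow {α : ℝ} (hα : 0 < α) (hα1 : α ≤ 1) :
    Tendsto (fun T : ℝ => (∫ t in T..(2 * T),
      ‖∑ n ∈ range (polyLength T), ((α + n : ℝ) : ℂ) ^ (-(1 / 2 + t * I))‖ ^ 2) /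
        (T * Real.log T)) atTop (nhds 1) := by
  have hH := tendsto_sum_inv_add_polyLength_div_log hα hα1
  have hdiff : Tendsto (fun T : ℝ => (∫ t in T..(2 * T),
      ‖∑ n ∈ range (polyLength T), ((α + n : ℝ) : ℂ) ^ (-(1 / 2 + t * I))‖ ^ 2) /
        (T * Real.log T) - (∑ n ∈ range (polyLength T), (α + n : ℝ)⁻¹) / Real.log T)
      atTop (nhds 0) := by
    have hbound : Tendsto (fun T => 16 * ((∑ n ∈ range (polyLength T), (α + n : ℝ)⁻¹) /
        Real.log T * (√(Real.log T))⁻¹)) atTop (nhds 0) := by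
      simpa using (hH.mul tendsto_inv_sqrt_log).const_mul 16
    refine squeeze_zero_norm' ?_ hbound
    filter_upwards [eventually_ge_atTop 1, Real.tendsto_log_atTop.eventually_gt_atTop 0,
      eventually_polyLength_le] with T hT hL hN
    have hT0 : 0 < T := by linarith
    set H := ∑ n ∈ range (polyLength T), (α + n : ℝ)⁻¹
    have hH0 : 0 ≤ H := sum_nonneg fun n _ => by positivity
    have h := abs_integral_normSq_sum_cpow_sub_le hα (polyLength T) T
    have hh := harmonic_le_sum_inv_add hα hα1 (polyLength T)
    have hsplit : ∀ x : ℝ, x / (T * Real.log T) - H / Real.log T =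
        (x - T * H) / (T * Real.log T) := by
      intro x
      field_simp
    rw [hsplit, Real.norm_eq_abs, abs_div, abs_of_pos (mul_pos hT0 hL),
      div_le_iff₀ (mul_pos hT0 hL)]
    calc _ ≤ 4 * polyLength T * (H + harmonic (polyLength T)) := h
      _ ≤ 4 * (2 * T / √(Real.log T)) * (H + H) :=
        mul_le_mul (by gcongr) (by gcongr) (add_nonneg hH0 (by
          rw [harmonic]
          positivity)) (by positivity)
      _ = _ := by
        field_simp
        ring
  simpa using hdiff.add hH

theorem tendsto_integral_norm_sq_hurwitzZeta_sub {α : ℝ} (hα : 0 < α) (hα1 : α ≤ 1) :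
    Tendsto (fun T : ℝ => (∫ t in T..(2 * T), ‖hurwitzZeta (α : UnitAddCircle) (1 / 2 + t * I) -
      ∑ n ∈ range (polyLength T), ((α + n : ℝ) : ℂ) ^ (-(1 / 2 + t * I))‖ ^ 2) /
        (T * Real.log T)) atTop (nhds 0) := by
  have hbound : Tendsto (fun T : ℝ => 6 * (Real.log T)⁻¹ + 20 * π * (√(Real.log T))⁻¹)
      atTop (nhds 0) := by
    simpa using ((tendsto_inv_atTop_zero.comp Real.tendsto_log_atTop).const_mul 6).add
      (tendsto_inv_sqrt_log.const_mul (20 * π))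
  refine squeeze_zero_norm' ?_ hbound
  filter_upwards [eventually_ge_atTop 1, Real.tendsto_log_atTop.eventually_ge_atTop 1,
    eventually_polyLength_le] with T hT hL hN
  have hT0 : 0 < T := by linarith
  have hL0 : 0 < Real.log T := by linarith
  have hsqrt : 1 ≤ √(Real.log T) := Real.one_le_sqrt.2 hL
  have hβ : T / √(Real.log T) ≤ α + polyLength T := (Nat.le_ceil _).trans (by
    rw [← polyLength]
    linarith)
  have hβ' : α + polyLength T ≤ 3 * T ^ 2 := by
    have : 2 * T / √(Real.log T) ≤ 2 * T := div_le_self (by linarith) hsqrt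
    nlinarith
  have h := integral_norm_sq_hurwitzZeta_sub_sum_cpow_le hα hα1 (polyLength T) hT
  rw [Real.norm_of_nonneg (div_nonneg (intervalIntegral.integral_nonneg (by linarith)
    fun _ _ => by positivity) (by positivity)), div_le_iff₀ (by positivity)]
  calc _ ≤ _ := h
    _ ≤ 2 * (3 * T ^ 2) / T + 20 * π * T ^ 2 / (T / √(Real.log T)) := by gcongr
    _ = (6 * (Real.log T)⁻¹ + 20 * π * (√(Real.log T) / Real.log T)) * (T * Real.log T) := by
      field_simp
      ring
    _ = _ := by rw [Real.sqrt_div_self]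

/-- The mean square of the Hurwitz zeta function on the critical line:
`∫_T^{2T} |ζ(1/2 + it, x)|² dt ∼ T log T`. -/
theorem tendsto_integral_norm_sq_hurwitzZeta (x : UnitAddCircle) :
    Tendsto (fun T : ℝ => (∫ t in T..(2 * T), ‖hurwitzZeta x (1 / 2 + t * I)‖ ^ 2) /
      (T * Real.log T)) atTop (nhds 1) := by
  obtain ⟨α, ⟨hα, hα1⟩, rfl⟩ : ∃ α ∈ Set.Ioc (0 : ℝ) 1, (α : UnitAddCircle) = x := by
    obtain ⟨h, h'⟩ := (AddCircle.equivIoc (1 : ℝ) 0 x).2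
    exact ⟨_, ⟨h, h'.trans_eq (zero_add 1)⟩, (AddCircle.equivIoc (1 : ℝ) 0).symm_apply_apply x⟩
  refine tendsto_of_abs_sub_le_mul_add (tendsto_integral_norm_sq_sum_cpow hα hα1)
    (tendsto_integral_norm_sq_hurwitzZeta_sub hα hα1) fun η hη => ?_
  filter_upwards [eventually_ge_atTop 0, Real.tendsto_log_atTop.eventually_ge_atTop 0] with T hT hL
  have hZ := continuous_hurwitzZeta_half α
  have hD := continuous_sum_cpow_half hα (polyLength T)
  have hZ2 := intervalIntegrable_norm_sq hZ T (2 * T)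
  have hD2 := intervalIntegrable_norm_sq hD T (2 * T)
  have hB2 := intervalIntegrable_norm_sq (hZ.sub hD) T (2 * T)
  simp only [Pi.sub_apply] at hB2
  rw [← sub_div, abs_div, abs_of_nonneg (mul_nonneg hT hL), ← mul_div_assoc, ← mul_div_assoc,
    ← add_div]
  refine div_le_div_of_nonneg_right ?_ (mul_nonneg hT hL)
  rw [← intervalIntegral.integral_sub hZ2 hD2,
    ← intervalIntegral.integral_const_mul, ← intervalIntegral.integral_const_mul,
    ← intervalIntegral.integral_add (hD2.const_mul _) (hB2.const_mul _)]
  rw [← Real.norm_eq_abs]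
  exact intervalIntegral.norm_integral_le_of_norm_le (by linarith)
    (Eventually.of_forall fun t _ => abs_norm_sq_sub_norm_sq_le _ _ hη)
    ((hD2.const_mul _).add (hB2.const_mul _))

theorem sum_integral_norm_sq_LFunction_half {q : ℕ} [NeZero q] (T : ℝ) :
    ∑ χ : DirichletCharacter ℂ q,
        ∫ t in T..(2 * T), ‖DirichletCharacter.LFunction χ (1 / 2 + t * I)‖ ^ 2 =
      q.totient / q * ∑ u : (ZMod q)ˣ, ∫ t in T..(2 * T),
        ‖hurwitzZeta (ZMod.toAddCircle (u : ZMod q)) (1 / 2 + t * I)‖ ^ 2 := by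
  have hL : ∀ χ : DirichletCharacter ℂ q,
      Continuous fun t : ℝ => DirichletCharacter.LFunction χ (1 / 2 + t * I) := fun χ =>
    (by fun_prop : Continuous fun t : ℝ => (q : ℂ) ^ (-(1 / 2 + t * I))).mul
      (continuous_finsetSum _ fun j _ => (continuous_hurwitzZeta_half _).const_mul (χ j))
  rw [← intervalIntegral.integral_finsetSum fun χ _ =>
      intervalIntegrable_norm_sq (hL χ) _ _,
    ← intervalIntegral.integral_finsetSum fun u _ =>
      intervalIntegrable_norm_sq (continuous_hurwitzZeta_half _) _ _,
    ← intervalIntegral.integral_const_mul]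
  exact intervalIntegral.integral_congr fun t _ => sum_norm_sq_LFunction_half t

/-- Unconditionally, for `α = a/q` with `gcd(a,q) = 1`,
`∫_T^{2T} |ζ(1/2+it,α)|² dt = (q/φ(q)²) ∑_χ ∫_T^{2T} |L(1/2+it,χ)|² dt + E(T)` with
`E(T) = o(T log T)`. -/
theorem hurwitz_second_moment_decomposition (a q : ℕ) [NeZero q] (ha : 1 ≤ a) (haq : a ≤ q)
    (hgcd : Nat.gcd a q = 1) :
    ∃ E : ℝ → ℝ,
      (∀ T : ℝ,
        (∫ t in T..(2*T),
            ‖hurwitzZeta (((a : ℝ) / (q : ℝ) : ℝ) : UnitAddCircle) (1/2 + t * Complex.I)‖ ^ 2)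
          = ((q : ℝ) / (q.totient : ℝ) ^ 2) *
              (∑ χ : DirichletCharacter ℂ q,
                ∫ t in T..(2*T), ‖DirichletCharacter.LFunction χ (1/2 + t * Complex.I)‖ ^ 2)
            + E T) ∧
      Tendsto (fun T : ℝ => E T / (T * Real.log T)) atTop (nhds 0) := by
  refine ⟨_, fun T => (add_sub_cancel _ _).symm, ?_⟩
  have hq : (q : ℝ) ≠ 0 := Nat.cast_ne_zero.2 (NeZero.ne q)
  have hφ : (q.totient : ℝ) ≠ 0 := Nat.cast_ne_zero.2 (Nat.totient_pos.2 (NeZero.pos q)).ne'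
  have hlim : Tendsto (fun T : ℝ => (∫ t in T..(2 * T),
      ‖hurwitzZeta (((a : ℝ) / (q : ℝ) : ℝ) : UnitAddCircle) (1 / 2 + t * I)‖ ^ 2) /
        (T * Real.log T) - (q.totient : ℝ)⁻¹ * ∑ u : (ZMod q)ˣ, (∫ t in T..(2 * T),
          ‖hurwitzZeta (ZMod.toAddCircle (u : ZMod q)) (1 / 2 + t * I)‖ ^ 2) / (T * Real.log T))
      atTop (nhds (1 - (q.totient : ℝ)⁻¹ * ∑ u : (ZMod q)ˣ, 1)) :=
    (tendsto_integral_norm_sq_hurwitzZeta _).sub ((tendsto_finsetSum _ fun u _ =>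
      tendsto_integral_norm_sq_hurwitzZeta _).const_mul _)
  have h0 : 1 - (q.totient : ℝ)⁻¹ * ∑ u : (ZMod q)ˣ, (1 : ℝ) = 0 := by
    rw [sum_const, card_univ, ZMod.card_units_eq_totient, nsmul_eq_mul, mul_one,
      inv_mul_cancel₀ hφ, sub_self]
  rw [h0] at hlim
  refine hlim.congr fun T => ?_
  have hc : (q : ℝ) / (q.totient : ℝ) ^ 2 * (q.totient / q) = (q.totient : ℝ)⁻¹ := by
    field_simp
  rw [sum_integral_norm_sq_LFunction_half, ← sum_div, sub_div, ← mul_div_assoc, ← mul_assoc, hc]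
end
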